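/- arXiv:math/0211314 — 13 statements merged into one kernel-verified Lean document; each statement's English description precedes it below -/
import Mathlib

section
/- Let k ≥ 2, r ≥ 1 and n ≥ (k+1)r be integers, and let 𝒜 ⊆ [n]^(r)_k be an intersecting family of k-separated r-subsets of [n] with |𝒜| = binomial(n−kr−1, r−1). Then there exists i ∈ [n] such that 𝒜 = {A ∈ [n]^(r)_k : i ∈ A}. -/
/-- The family of all `k`-separated `r`-subsets of `[n] = {1,…,n}`:
`A = {a₁ < … < a_r} ⊆ [n]` with consecutive circular gaps all `> k`.
Equivalently (for nonempty `A`): `k < n` and every pair `a < b` in `A`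
satisfies `b - a > k` and `(a + n) - b > k`. -/
def sepSets (n k r : ℕ) : Finset (Finset ℕ) :=
  (Finset.Icc 1 n).powerset.filter fun A =>
    A.card = r ∧ k < n ∧ ∀ a ∈ A, ∀ b ∈ A, a < b → k < b - a ∧ b - a + k < n

/-- A family of sets is intersecting if any two members meet. -/
def Intersecting (𝒜 : Finset (Finset ℕ)) : Prop :=
  ∀ A ∈ 𝒜, ∀ B ∈ 𝒜, (A ∩ B).Nonempty


namespace SepFam

/-- Separation condition without the cardinality requirement. -/
def Sep (n k : ℕ) (A : Finset ℕ) : Prop :=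
  (∀ x ∈ A, 1 ≤ x ∧ x ≤ n) ∧ k < n ∧ ∀ a ∈ A, ∀ b ∈ A, a < b → a + k < b ∧ b + k < n + a

lemma mem_sep {n k r : ℕ} {A : Finset ℕ} : A ∈ sepSets n k r ↔ Sep n k A ∧ A.card = r := by
  unfold sepSets Sep
  simp only [Finset.mem_filter, Finset.mem_powerset, Finset.subset_iff, Finset.mem_Icc]
  constructor
  · rintro ⟨h1, h2, h3, h4⟩
    refine ⟨⟨fun x hx => h1 hx, h3, fun a ha b hb hab => ?_⟩, h2⟩
    have := h4 a ha b hb hab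
    omega
  · rintro ⟨⟨h1, h3, h4⟩, h2⟩
    refine ⟨fun x hx => h1 x hx, h2, h3, fun a ha b hb hab => ?_⟩
    have := h4 a ha b hb hab
    omega

/-- Merge the points `n - 1` and `n`. -/
def phi (n x : ℕ) : ℕ := if x = n then n - 1 else x

/-- The part of the family which is not handled by merging. -/
def Efam (n k r : ℕ) (F : Finset (Finset ℕ)) : Finset (Finset ℕ) :=
  F.filter fun A => A.image (phi n) ∉ sepSets (n - 1) k r ∨ (n ∈ A ∧ A.image (phi n) ∈ F)

/-- Sets whose last element is forced by the rest. -/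
def Q (n k : ℕ) (A : Finset ℕ) : Prop :=
  Sep n k A ∧ ∃ t ∈ A, n < t + k + 1 ∧ (t = n ∨ ∃ j ∈ A, j ≤ k ∧ t + k + 1 = n + j)

/-- Restriction to the first `n - k - 1` points. -/
def g (n k : ℕ) (A : Finset ℕ) : Finset ℕ := A.filter fun x => x + k + 1 ≤ n

lemma mem_g {n k x : ℕ} {A : Finset ℕ} : x ∈ g n k A ↔ x ∈ A ∧ x + k + 1 ≤ n := by
  simp [g]

lemma top_unique {n k : ℕ} {A : Finset ℕ} (h : Sep n k A) {s t : ℕ} (hs : s ∈ A) (ht : t ∈ A)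
    (hs' : n < s + k + 1) (ht' : n < t + k + 1) : s = t := by
  have h1 := h.1 s hs
  have h2 := h.1 t ht
  rcases lt_trichotomy s t with h3 | h3 | h3
  · have := h.2.2 s hs t ht h3; omega
  · exact h3
  · have := h.2.2 t ht s hs h3; omega

lemma Q_mem {n k r : ℕ} (hn : 2 * k + 2 ≤ n) {A : Finset ℕ} (hQ : Q n k A) (hc : A.card = r) :
    g n k A ∈ sepSets (n - k - 1) k (r - 1) := by
  obtain ⟨hS, t, ht, htn, -⟩ := hQ
  have hg : g n k A = A.erase t := by
    ext x
    rw [mem_g, Finset.mem_erase]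
    constructor
    · rintro ⟨h1, h2⟩
      exact ⟨by rintro rfl; omega, h1⟩
    · rintro ⟨h1, h2⟩
      refine ⟨h2, ?_⟩
      by_contra h3
      exact h1 (top_unique hS h2 ht (by omega) htn)
  rw [mem_sep]
  refine ⟨⟨?_, by omega, ?_⟩, ?_⟩
  · intro x hx
    rw [mem_g] at hx
    have := hS.1 x hx.1
    omega
  · intro a ha b hb hab
    rw [mem_g] at ha hb
    have h1 := hS.2.2 a ha.1 b hb.1 hab
    have h2 := hS.2.2 a ha.1 t ht (by omega)
    have h3 := hS.2.2 b hb.1 t ht (by omega)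
    omega
  · rw [hg, Finset.card_erase_of_mem ht, hc]

lemma Q_sub {n k : ℕ} (hn : 2 * k + 2 ≤ n) {A B : Finset ℕ} (hA : Q n k A) (hB : Q n k B)
    (h : g n k A = g n k B) : A ⊆ B := by
  obtain ⟨hSA, s, hs, hsn, hs'⟩ := hA
  obtain ⟨hSB, t, ht, htn, ht'⟩ := hB
  have tr : ∀ x, x + k + 1 ≤ n → (x ∈ A ↔ x ∈ B) := by
    intro x hx
    have : x ∈ g n k A ↔ x ∈ g n k B := by rw [h]
    rw [mem_g, mem_g] at this
    tauto
  have hst : s = t := by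
    rcases hs' with rfl | ⟨i, hi, hik, hi'⟩
    · rcases ht' with rfl | ⟨j, hj, hjk, hj'⟩
      · rfl
      · have hjA := (tr j (by omega)).2 hj
        have := hSA.2.2 j hjA s hs (by omega)
        omega
    · rcases ht' with rfl | ⟨j, hj, hjk, hj'⟩
      · have hjA := (tr i (by omega)).1 hi
        have := hSB.2.2 i hjA t ht (by omega)
        omega
      · have hjA := (tr j (by omega)).2 hj
        have h1 := hSA.1 i hi
        have h2 := hSA.1 j hjA
        rcases lt_trichotomy i j with h3 | h3 | h3
        · have := hSA.2.2 i hi j hjA h3; omega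
        · omega
        · have := hSA.2.2 j hjA i hi h3; omega
  intro x hx
  by_cases hxn : x + k + 1 ≤ n
  · exact (tr x hxn).1 hx
  · rw [top_unique hSA hx hs (by omega) hsn, hst]; exact ht

lemma Q_inj {n k : ℕ} (hn : 2 * k + 2 ≤ n) {A B : Finset ℕ} (hA : Q n k A) (hB : Q n k B)
    (h : g n k A = g n k B) : A = B :=
  Finset.Subset.antisymm (Q_sub hn hA hB h) (Q_sub hn hB hA h.symm)

lemma image_phi_of_notMem {n : ℕ} {A : Finset ℕ} (h : n ∉ A) : A.image (phi n) = A := by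
  ext x
  simp only [Finset.mem_image, phi]
  constructor
  · rintro ⟨a, ha, rfl⟩
    rw [if_neg (by rintro rfl; exact h ha)]; exact ha
  · intro hx
    exact ⟨x, hx, if_neg (by rintro rfl; exact h hx)⟩

lemma mem_image_phi {n x : ℕ} {A : Finset ℕ} (h : n ∈ A) (hn : 1 ≤ n) :
    x ∈ A.image (phi n) ↔ x = n - 1 ∨ (x ∈ A ∧ x ≠ n) := by
  simp only [Finset.mem_image, phi]
  constructor
  · rintro ⟨a, ha, rfl⟩
    by_cases h1 : a = n
    · simp [h1]
    · simp [h1, ha]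
  · rintro (rfl | ⟨h1, h2⟩)
    · exact ⟨n, h, if_pos rfl⟩
    · exact ⟨x, h1, if_neg h2⟩

lemma image_phi_mem {n k r : ℕ} (hk : 1 ≤ k) (hn : 2 * k + 2 ≤ n) {A : Finset ℕ}
    (hA : A ∈ sepSets n k r) (hnA : n ∈ A) (h : n - 1 - k ∉ A) :
    A.image (phi n) ∈ sepSets (n - 1) k r := by
  rw [mem_sep] at hA ⊢
  obtain ⟨hS, hc⟩ := hA
  have key : ∀ x ∈ A, x ≠ n → k < x ∧ x + k + 1 < n := by
    intro x hx hxn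
    have h1 := hS.1 x hx
    have h2 := hS.2.2 x hx n hnA (by omega)
    have h3 : x ≠ n - 1 - k := by rintro rfl; exact h hx
    omega
  refine ⟨⟨?_, by omega, ?_⟩, ?_⟩
  · intro x hx
    rw [mem_image_phi hnA (by omega)] at hx
    rcases hx with rfl | ⟨hx, hx'⟩
    · omega
    · have := key x hx hx'; omega
  · intro a ha b hb hab
    rw [mem_image_phi hnA (by omega)] at ha hb
    rcases ha with rfl | ⟨ha, ha'⟩ <;> rcases hb with rfl | ⟨hb, hb'⟩
    · omega
    · have := key b hb hb'; omega
    · have := key a ha ha'; omega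
    · have := key a ha ha'
      have := key b hb hb'
      have := hS.2.2 a ha b hb hab
      omega
  · rw [Finset.card_image_of_injOn, hc]
    intro a ha b hb hab
    simp only [phi] at hab
    by_cases h1 : a = n <;> by_cases h2 : b = n
    · omega
    · have := key b hb h2
      simp only [h1, h2, if_true, if_false] at hab; omega
    · have := key a ha h1
      simp only [h1, h2, if_true, if_false] at hab; omega
    · simpa only [h1, h2, if_false] using hab

lemma Efam_Q {n k r : ℕ} (hn : 2 * k + 2 ≤ n) (hk : 1 ≤ k) {F : Finset (Finset ℕ)}
    (hF : F ⊆ sepSets n k r) {A : Finset ℕ} (hA : A ∈ Efam n k r F) : Q n k A := by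
  rw [Efam, Finset.mem_filter] at hA
  obtain ⟨hAF, hA⟩ := hA
  obtain ⟨hS, hc⟩ := mem_sep.1 (hF hAF)
  refine ⟨hS, ?_⟩
  by_cases hnA : n ∈ A
  · exact ⟨n, hnA, by omega, Or.inl rfl⟩
  · rw [image_phi_of_notMem hnA] at hA
    rcases hA with hA | hA
    · by_contra hcon
      push Not at hcon
      apply hA
      rw [mem_sep]
      refine ⟨⟨?_, by omega, ?_⟩, hc⟩
      · intro x hx
        have h1 := hS.1 x hx
        have : x ≠ n := by rintro rfl; exact hnA hx
        omega
      · intro a ha b hb hab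
        have h1 := hS.2.2 a ha b hb hab
        refine ⟨h1.1, ?_⟩
        by_contra h2
        have h3 := hS.1 b hb
        have h5 := hS.1 a ha
        have : b ≠ n := by rintro rfl; exact hnA hb
        have h4 := (hcon b hb (by omega)).2 a ha (by omega)
        omega
    · exact absurd hA.1 hnA

lemma g_inter {n k r : ℕ} (hn : 2 * k + 2 ≤ n) (hk : 1 ≤ k) {F : Finset (Finset ℕ)}
    (hF : F ⊆ sepSets n k r) (hI : Intersecting F) :
    Intersecting ((Efam n k r F).image (g n k)) := by
  intro A' hA' B' hB'
  rw [Finset.mem_image] at hA' hB'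
  obtain ⟨A, hA, rfl⟩ := hA'
  obtain ⟨B, hB, rfl⟩ := hB'
  have hQA := Efam_Q hn hk hF hA
  have hQB := Efam_Q hn hk hF hB
  have hA1 := hA
  have hB1 := hB
  rw [Efam, Finset.mem_filter] at hA1 hB1
  suffices h : ∃ x ∈ A, x ∈ B ∧ x + k + 1 ≤ n by
    obtain ⟨x, h1, h2, h3⟩ := h
    exact ⟨x, Finset.mem_inter.2 ⟨mem_g.2 ⟨h1, h3⟩, mem_g.2 ⟨h2, h3⟩⟩⟩
  obtain ⟨x, hx⟩ := hI A hA1.1 B hB1.1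
  rw [Finset.mem_inter] at hx
  obtain ⟨hxA, hxB⟩ := hx
  by_cases hxn : x + k + 1 ≤ n
  · exact ⟨x, hxA, hxB, hxn⟩
  by_cases hxe : x = n
  · subst hxe
    -- both contain the last point
    have aux : ∀ C D : Finset ℕ, Sep x k C → Sep x k D → D ∈ F → x ∈ C → x ∈ D →
        C.image (phi x) ∈ F → ∃ y ∈ C, y ∈ D ∧ y + k + 1 ≤ x := by
      intro C D hC hSD hD hxC hxD hCF
      obtain ⟨y, hy⟩ := hI _ hCF D hD
      rw [Finset.mem_inter, mem_image_phi hxC (by omega)] at hy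
      obtain ⟨hy, hyD⟩ := hy
      have hyne : y ≠ x - 1 := by
        rintro rfl
        have := hSD.2.2 _ hyD x hxD (by omega)
        omega
      rcases hy with hy | ⟨hy, hyx⟩
      · exact absurd hy hyne
      · refine ⟨y, hy, hyD, ?_⟩
        have := hC.1 y hy
        have := hC.2.2 y hy x hxC (by omega)
        omega
    have hSA := hQA.1
    have hSB := hQB.1
    by_cases h1 : A.image (phi x) ∈ F
    · exact aux A B hSA hSB hB1.1 hxA hxB h1
    by_cases h2 : B.image (phi x) ∈ F
    · obtain ⟨y, ya, yb, yc⟩ := aux B A hSB hSA hA1.1 hxB hxA h2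
      exact ⟨y, yb, ya, yc⟩
    have h3 : x - 1 - k ∈ A := by
      by_contra h
      have := image_phi_mem hk hn (hF hA1.1) hxA h
      tauto
    have h4 : x - 1 - k ∈ B := by
      by_contra h
      have := image_phi_mem hk hn (hF hB1.1) hxB h
      tauto
    exact ⟨_, h3, h4, by omega⟩
  · obtain ⟨hSA, s, hs, hsn, hs'⟩ := hQA
    obtain ⟨hSB, t, ht, htn, ht'⟩ := hQB
    have e1 := top_unique hSA hxA hs (by omega) hsn
    have e2 := top_unique hSB hxB ht (by omega) htn
    subst e1
    subst e2
    obtain ⟨i, hi, hik, hi'⟩ := hs'.resolve_left hxe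
    obtain ⟨j, hj, hjk, hj'⟩ := ht'.resolve_left hxe
    have : i = j := by omega
    subst this
    exact ⟨i, hi, hj, by omega⟩

lemma phi_inter {n k r : ℕ} {F : Finset (Finset ℕ)} (hI : Intersecting F) :
    Intersecting ((F \ Efam n k r F).image fun A => A.image (phi n)) := by
  intro A' hA' B' hB'
  rw [Finset.mem_image] at hA' hB'
  obtain ⟨A, hA, rfl⟩ := hA'
  obtain ⟨B, hB, rfl⟩ := hB'
  rw [Finset.mem_sdiff] at hA hB
  obtain ⟨x, hx⟩ := hI A hA.1 B hB.1
  rw [Finset.mem_inter] at hx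
  exact ⟨phi n x, Finset.mem_inter.2
    ⟨Finset.mem_image_of_mem _ hx.1, Finset.mem_image_of_mem _ hx.2⟩⟩

lemma notE {n k r : ℕ} {F : Finset (Finset ℕ)} {A : Finset ℕ} (hA : A ∈ F \ Efam n k r F) :
    A ∈ F ∧ A.image (phi n) ∈ sepSets (n - 1) k r ∧ (n ∈ A → A.image (phi n) ∉ F) := by
  rw [Finset.mem_sdiff, Efam, Finset.mem_filter] at hA
  tauto

lemma phi_card {n k r : ℕ} (hk : 1 ≤ k) (hn : 1 ≤ n) {F : Finset (Finset ℕ)}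
    (hF : F ⊆ sepSets n k r) :
    ((F \ Efam n k r F).image fun A => A.image (phi n)).card = (F \ Efam n k r F).card := by
  apply Finset.card_image_of_injOn
  intro A hA B hB hAB
  have hA := notE (Finset.mem_coe.1 hA)
  have hB := notE (Finset.mem_coe.1 hB)
  simp only at hAB
  have sub : ∀ C D : Finset ℕ, C ∈ F → n ∈ C → n ∈ D → C.image (phi n) = D.image (phi n) →
      C ⊆ D := by
    intro C D hC hnC hnD h x hx
    by_cases hxn : x = n
    · rw [hxn]; exact hnD
    have h1 : x ∈ D.image (phi n) := by
      rw [← h, mem_image_phi hnC hn]; exact Or.inr ⟨hx, hxn⟩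
    rw [mem_image_phi hnD hn] at h1
    rcases h1 with rfl | h1
    · have := (mem_sep.1 (hF hC)).1.2.2 _ hx n hnC (by omega)
      omega
    · exact h1.1
  by_cases h1 : n ∈ A <;> by_cases h2 : n ∈ B
  · exact Finset.Subset.antisymm (sub A B hA.1 h1 h2 hAB) (sub B A hB.1 h2 h1 hAB.symm)
  · have := hA.2.2 h1
    rw [hAB, image_phi_of_notMem h2] at this
    exact absurd hB.1 this
  · have := hB.2.2 h2
    rw [← hAB, image_phi_of_notMem h1] at this
    exact absurd hA.1 this
  · rwa [image_phi_of_notMem h1, image_phi_of_notMem h2] at hAB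

lemma g_card {n k r : ℕ} (hn : 2 * k + 2 ≤ n) (hk : 1 ≤ k) {F : Finset (Finset ℕ)}
    (hF : F ⊆ sepSets n k r) :
    ((Efam n k r F).image (g n k)).card = (Efam n k r F).card := by
  apply Finset.card_image_of_injOn
  intro A hA B hB hAB
  exact Q_inj hn (Efam_Q hn hk hF (Finset.mem_coe.1 hA)) (Efam_Q hn hk hF (Finset.mem_coe.1 hB)) hAB

lemma g_subset {n k r : ℕ} (hn : 2 * k + 2 ≤ n) (hk : 1 ≤ k) {F : Finset (Finset ℕ)}
    (hF : F ⊆ sepSets n k r) :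
    (Efam n k r F).image (g n k) ⊆ sepSets (n - k - 1) k (r - 1) := by
  intro A' hA'
  rw [Finset.mem_image] at hA'
  obtain ⟨A, hA, rfl⟩ := hA'
  have hAF : A ∈ F := Finset.mem_of_mem_filter _ hA
  exact Q_mem hn (Efam_Q hn hk hF hA) (mem_sep.1 (hF hAF)).2

lemma phi_subset {n k r : ℕ} {F : Finset (Finset ℕ)} :
    ((F \ Efam n k r F).image fun A => A.image (phi n)) ⊆ sepSets (n - 1) k r := by
  intro A' hA'
  rw [Finset.mem_image] at hA'
  obtain ⟨A, hA, rfl⟩ := hA'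
  exact (notE hA).2.1

lemma split_card {n k r : ℕ} (F : Finset (Finset ℕ)) :
    F.card = (F \ Efam n k r F).card + (Efam n k r F).card := by
  have : Efam n k r F ⊆ F := Finset.filter_subset _ _
  rw [Finset.card_sdiff_add_card_eq_card this]

lemma two_le {n k r : ℕ} (hr : 2 ≤ r) {A : Finset ℕ} (hA : A ∈ sepSets n k r) :
    2 * k + 2 ≤ n := by
  obtain ⟨hS, hc⟩ := mem_sep.1 hA
  obtain ⟨a, ha, b, hb, hab⟩ := Finset.one_lt_card.1 (show 1 < A.card by omega)
  rcases lt_or_gt_of_ne hab with h | h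
  · have := hS.2.2 a ha b hb h; omega
  · have := hS.2.2 b hb a ha h; omega

/-- The upper bound. -/
theorem upper (k : ℕ) (hk : 1 ≤ k) (n : ℕ) : ∀ r, 1 ≤ r → ∀ F : Finset (Finset ℕ),
    F ⊆ sepSets n k r → Intersecting F → F.card ≤ (n - k * r - 1).choose (r - 1) := by
  induction n using Nat.strong_induction_on with
  | _ n ih =>
  intro r hr F hF hI
  obtain rfl | hr2 : r = 1 ∨ 2 ≤ r := by omega
  · simp only [Nat.sub_self, Nat.choose_zero_right]
    rw [Finset.card_le_one]
    intro A hA B hB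
    obtain ⟨x, hx⟩ := hI A hA B hB
    obtain ⟨a, rfl⟩ := Finset.card_eq_one.1 (mem_sep.1 (hF hA)).2
    obtain ⟨b, rfl⟩ := Finset.card_eq_one.1 (mem_sep.1 (hF hB)).2
    simp only [Finset.mem_inter, Finset.mem_singleton] at hx
    rw [← hx.1, ← hx.2]
  · rcases F.eq_empty_or_nonempty with rfl | ⟨A, hA⟩
    · simp
    have hn := two_le hr2 (hF hA)
    have h1 := ih (n - 1) (by omega) r hr _ (phi_subset (n := n) (k := k) (r := r) (F := F))
      (phi_inter hI)
    have h2 := ih (n - k - 1) (by omega) (r - 1) (by omega) _ (g_subset hn hk hF) (g_inter hn hk hF hI)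
    rw [phi_card hk (by omega) hF] at h1
    rw [g_card hn hk hF] at h2
    rw [split_card (n := n) (k := k) (r := r) F]
    obtain ⟨s, rfl⟩ : ∃ s, r = s + 2 := ⟨r - 2, by omega⟩
    have e1 : n - 1 - k * (s + 2) - 1 = n - k * (s + 2) - 1 - 1 := by omega
    have e2 : n - k - 1 - k * (s + 2 - 1) - 1 = n - k * (s + 2) - 1 - 1 := by
      have : k * (s + 2) = k * (s + 2 - 1) + k := by
        rw [show s + 2 - 1 = s + 1 by omega]; ring
      omega
    rw [e1] at h1
    rw [e2] at h2
    simp only [show s + 2 - 1 = s + 1 by omega, show s + 1 - 1 = s by omega] at h1 h2 ⊢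
    by_cases hN : n - k * (s + 2) - 1 = 0
    · rw [hN] at h1 h2 ⊢
      rcases Nat.eq_zero_or_pos s with rfl | hs
      · omega
      · rw [Nat.choose_eq_zero_of_lt (by omega)] at h1 h2 ⊢
        omega
    · obtain ⟨N, hN'⟩ : ∃ N, n - k * (s + 2) - 1 = N + 1 := ⟨n - k * (s + 2) - 1 - 1, by omega⟩
      rw [hN'] at h1 h2 ⊢
      rw [Nat.choose_succ_succ]
      simp only [Nat.add_sub_cancel] at h1 h2
      simp only [Nat.succ_eq_add_one]
      omega

/-- Rotation of `[n]` by `t`. -/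
def rot (n t x : ℕ) : ℕ := if x + t ≤ n then x + t else x + t - n

lemma rot_cases (n t x : ℕ) : (x + t ≤ n ∧ rot n t x = x + t) ∨
    (n < x + t ∧ rot n t x + n = x + t) := by
  unfold rot
  split_ifs <;> omega

lemma rot_sep {n k t : ℕ} (ht : t ≤ n) {A : Finset ℕ} (hA : Sep n k A) :
    Sep n k (A.image (rot n t)) := by
  refine ⟨?_, hA.2.1, ?_⟩
  · intro x hx
    obtain ⟨y, hy, rfl⟩ := Finset.mem_image.1 hx
    have := hA.1 y hy
    rcases rot_cases n t y with h | h <;> omega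
  · intro a ha b hb hab
    obtain ⟨x, hx, rfl⟩ := Finset.mem_image.1 ha
    obtain ⟨y, hy, rfl⟩ := Finset.mem_image.1 hb
    have h1 := hA.1 x hx
    have h2 := hA.1 y hy
    rcases lt_trichotomy x y with h | h | h
    · have h3 := hA.2.2 x hx y hy h
      rcases rot_cases n t x with h' | h' <;> rcases rot_cases n t y with h'' | h'' <;> omega
    · subst h; omega
    · have h3 := hA.2.2 y hy x hx h
      rcases rot_cases n t x with h' | h' <;> rcases rot_cases n t y with h'' | h'' <;> omega

lemma rot_inj {n t x y : ℕ} (hx : 1 ≤ x ∧ x ≤ n) (hy : 1 ≤ y ∧ y ≤ n)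
    (h : rot n t x = rot n t y) : x = y := by
  rcases rot_cases n t x with h' | h' <;> rcases rot_cases n t y with h'' | h'' <;> omega

lemma rot_card {n k t : ℕ} {A : Finset ℕ} (hA : Sep n k A) :
    (A.image (rot n t)).card = A.card := by
  apply Finset.card_image_of_injOn
  intro x hx y hy h
  exact rot_inj (hA.1 x hx) (hA.1 y hy) h

lemma rot_mem {n k r t : ℕ} (ht : t ≤ n) {A : Finset ℕ} (hA : A ∈ sepSets n k r) :
    A.image (rot n t) ∈ sepSets n k r := by
  obtain ⟨h1, h2⟩ := mem_sep.1 hA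
  exact mem_sep.2 ⟨rot_sep ht h1, by rw [rot_card h1, h2]⟩

lemma rot_disj {n k t : ℕ} {A : Finset ℕ} (hA : Sep n k A)
    (ht : 1 ≤ t ∧ t < n) (ht' : t ≤ k ∨ n ≤ t + k) :
    ∀ x ∈ A.image (rot n t), x ∉ A := by
  intro x hx hxA
  obtain ⟨y, hy, rfl⟩ := Finset.mem_image.1 hx
  have h1 := hA.1 y hy
  rcases rot_cases n t y with h | h
  · have := hA.2.2 y hy _ hxA (by omega)
    omega
  · have := hA.2.2 _ hxA y hy (by omega)
    omega

lemma avoid {m k r d : ℕ} (hk : 1 ≤ k) (hr : 1 ≤ r) {U : Finset ℕ} (hU : U ∈ sepSets m k r)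
    (hd : 1 ≤ d ∧ d ≤ m) (hdU : d ∉ U) :
    ∃ T ∈ sepSets m k r, d ∈ T ∧ ∀ x ∈ T, x ∉ U := by
  obtain ⟨hS, hc⟩ := mem_sep.1 hU
  -- a rotation amount bringing a point of `U` to `d`
  by_cases h : ∃ u ∈ U, ∃ t, 1 ≤ t ∧ t < m ∧ (t ≤ k ∨ m ≤ t + k) ∧ rot m t u = d
  · obtain ⟨u, hu, t, h1, h2, h3, h4⟩ := h
    exact ⟨U.image (rot m t), rot_mem (by omega) hU, h4 ▸ Finset.mem_image_of_mem _ hu,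
      rot_disj hS ⟨h1, h2⟩ h3⟩
  · push Not at h
    have hm := hS.2.1
    have far : ∀ u ∈ U, (u < d → u + k < d ∧ d + k < m + u) ∧
        (d < u → d + k < u ∧ u + k < m + d) := by
      intro u hu
      have h1 := hS.1 u hu
      constructor
      · intro hud
        have h2 := h u hu (d - u) (by omega) (by omega)
        have h3 : rot m (d - u) u = d := by
          rcases rot_cases m (d - u) u with h' | h' <;> omega
        have h4 : ¬ (d - u ≤ k ∨ m ≤ d - u + k) := fun h' => h2 h' h3
        omega
      · intro hud
        have h2 := h u hu (m + d - u) (by omega) (by omega)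
        have h3 : rot m (m + d - u) u = d := by
          rcases rot_cases m (m + d - u) u with h' | h' <;> omega
        have h4 : ¬ (m + d - u ≤ k ∨ m ≤ m + d - u + k) := fun h' => h2 h' h3
        omega
    -- the point to remove
    obtain ⟨u, hu, hu'⟩ : ∃ u ∈ U, ∀ v ∈ U, v ≠ u →
        ¬ (v + k + 1 = d ∨ v + k + 1 = d + m) := by
      by_cases hex : ∃ u ∈ U, (u + k + 1 = d ∨ u + k + 1 = d + m)
      · obtain ⟨u, hu, hu'⟩ := hex
        refine ⟨u, hu, fun v hv hvu => ?_⟩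
        have := hS.1 u hu
        have := hS.1 v hv
        omega
      · push Not at hex
        obtain ⟨u, hu⟩ := Finset.card_pos.1 (show 0 < U.card by omega)
        exact ⟨u, hu, fun v hv _ => by have := hex v hv; omega⟩
    have hS' : Sep m k (U.erase u) :=
      ⟨fun x hx => hS.1 x (Finset.mem_of_mem_erase hx), hS.2.1,
        fun a ha b hb => hS.2.2 a (Finset.mem_of_mem_erase ha) b (Finset.mem_of_mem_erase hb)⟩
    have hR := rot_sep (t := 1) (by omega) hS'
    have dist : ∀ y ∈ (U.erase u).image (rot m 1), (y < d → y + k < d ∧ d + k < m + y) ∧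
        (d < y → d + k < y ∧ y + k < m + d) ∧ y ≠ d := by
      intro y hy
      obtain ⟨x, hx, rfl⟩ := Finset.mem_image.1 hy
      rw [Finset.mem_erase] at hx
      have h1 := hu' x hx.2 hx.1
      have h2 := far x hx.2
      have h3 := hS.1 x hx.2
      have h4 : x ≠ d := by rintro rfl; exact hdU hx.2
      rcases rot_cases m 1 x with h' | h' <;> omega
    refine ⟨insert d ((U.erase u).image (rot m 1)), mem_sep.2 ⟨⟨?_, hS.2.1, ?_⟩, ?_⟩,
      Finset.mem_insert_self _ _, ?_⟩
    · intro x hx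
      rcases Finset.mem_insert.1 hx with rfl | hx
      · exact hd
      · exact hR.1 x hx
    · intro a ha b hb hab
      rcases Finset.mem_insert.1 ha with h1 | h1 <;> rcases Finset.mem_insert.1 hb with h2 | h2
      · omega
      · rw [h1] at hab ⊢; exact (dist b h2).2.1 hab
      · rw [h2] at hab ⊢; exact (dist a h1).1 hab
      · exact hR.2.2 a h1 b h2 hab
    · rw [Finset.card_insert_of_notMem, rot_card hS', Finset.card_erase_of_mem hu]
      · omega
      · intro h'
        exact (dist d h').2.2 rfl
    · intro x hx hxU
      rcases Finset.mem_insert.1 hx with rfl | hx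
      · exact hdU hxU
      · obtain ⟨y, hy, rfl⟩ := Finset.mem_image.1 hx
        have hyU := Finset.mem_of_mem_erase hy
        have h3 := hS.1 y hyU
        exact rot_disj hS (t := 1) ⟨le_refl _, by omega⟩ (Or.inl hk) _
          (Finset.mem_image_of_mem _ hyU) hxU

/-- Choice of the pair around the merged point. -/
lemma choose_gap {m k a b : ℕ} (hk : 2 ≤ k) {S : Finset ℕ} (hS : Sep m k S)
    (hm : 2 * k + 1 < m)
    (ha : 1 ≤ a ∧ a ≤ k) (hb : m ≤ b + k ∧ b < m) (hab : b + k < m + a) (haS : a ∉ S)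
    (hbS : b ∉ S) :
    ∃ i, i ≤ k ∧ k ≤ i + a ∧ b + i ≤ m ∧ m - i ∉ S ∧ (i < k → k - i ∉ S) ∧ (i = k → m ∉ S) := by
  have close : ∀ x ∈ S, ∀ y ∈ S, x < y → y + k < m + x := fun x hx y hy h =>
    (hS.2.2 x hx y hy h).2
  have close' : ∀ x ∈ S, ∀ y ∈ S, x < y → x + k < y := fun x hx y hy h =>
    (hS.2.2 x hx y hy h).1
  by_cases h1 : a = k ∧ m = b + k
  · obtain ⟨rfl, h1⟩ := h1
    by_cases hmS : m ∈ S
    · refine ⟨1, by omega, by omega, by omega, ?_, ?_, by omega⟩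
      · intro h; have := close' _ h m hmS (by omega); omega
      · intro _ h; have := close _ h m hmS (by omega); omega
    · refine ⟨a, by omega, by omega, by omega, ?_, by omega, fun _ => hmS⟩
      rw [show m - a = b by omega]; exact hbS
  · -- keep `a`
    by_cases h2 : m - (k - a) ∈ S
    · -- keep `b`
      refine ⟨m - b, by omega, by omega, by omega, ?_, ?_, ?_⟩
      · rw [show m - (m - b) = b by omega]; exact hbS
      · intro h3 h4
        have := close _ h4 _ h2 (by omega); omega
      · intro h3 h4
        have := close' _ h2 _ h4 (by omega); omega
    · refine ⟨k - a, by omega, by omega, by omega, h2, ?_, by omega⟩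
      intro _
      rw [show k - (k - a) = a by omega]; exact haS

/-- Extremal `E`-part which is a star with centre away from the merged point. -/
lemma nonwindow {n k r d : ℕ} (hk : 2 ≤ k) (hr : 2 ≤ r) (hn : 2 * k + 3 ≤ n)
    {F : Finset (Finset ℕ)} (hF : F ⊆ sepSets n k r) (hI : Intersecting F)
    (hd : k < d ∧ d + k + 1 < n)
    (hE1 : ∀ A ∈ Efam n k r F, d ∈ A)
    (hE2 : ∀ B ∈ sepSets n k r, Q n k B → d ∈ B → B ∈ Efam n k r F) :
    ∀ A ∈ F, d ∈ A := by
  intro S hSF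
  by_contra hdS
  have hSE : S ∈ F \ Efam n k r F :=
    Finset.mem_sdiff.2 ⟨hSF, fun h => hdS (hE1 S h)⟩
  obtain ⟨-, hS1, -⟩ := notE hSE
  have hSsep := (mem_sep.1 (hF hSF)).1
  set U := S.image (phi n) with hU
  have toU : ∀ x ∈ S, x ≠ n → x ∈ U := by
    intro x hx hxn
    rw [hU, Finset.mem_image]
    exact ⟨x, hx, if_neg hxn⟩
  have toU' : n ∈ S → n - 1 ∈ U := by
    intro h
    rw [hU, Finset.mem_image]
    exact ⟨n, h, if_pos rfl⟩
  have hdU : d ∉ U := by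
    rw [hU, Finset.mem_image]
    rintro ⟨x, hx, hxd⟩
    unfold phi at hxd
    split_ifs at hxd with h
    · omega
    · subst hxd; exact hdS hx
  have hUsep := (mem_sep.1 hS1).1
  obtain ⟨T, hT, hdT, hTU⟩ := avoid (by omega) (by omega) hS1 (by omega) hdU
  obtain ⟨hTsep, hTc⟩ := mem_sep.1 hT
  -- finishing with a set containing the merged point
  have finG : ∀ A ∈ sepSets (n - 1) k r, d ∈ A → n - 1 ∈ A → (∀ x ∈ A, x ∈ U → x = n - 1) →
      False := by
    intro A hA hdA hmA hAU
    obtain ⟨hAsep, hAc⟩ := mem_sep.1 hA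
    have hnA : n ∉ A := by intro h; have := hAsep.1 n h; omega
    have hnA' : n ∉ A.erase (n - 1) := fun h => hnA (Finset.mem_of_mem_erase h)
    have nB : n ∈ insert n (A.erase (n - 1)) := Finset.mem_insert_self _ _
    have hBsep : Sep n k (insert n (A.erase (n - 1))) := by
      refine ⟨?_, by omega, ?_⟩
      · intro x hx
        rcases Finset.mem_insert.1 hx with rfl | hx
        · omega
        · have := hAsep.1 x (Finset.mem_of_mem_erase hx); omega
      · intro a ha b hb hab
        rcases Finset.mem_insert.1 ha with rfl | ha <;> rcases Finset.mem_insert.1 hb with rfl | hb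
        · omega
        · have := hAsep.1 b (Finset.mem_of_mem_erase hb); omega
        · rw [Finset.mem_erase] at ha
          have h0 := hAsep.1 a ha.2
          have := hAsep.2.2 a ha.2 _ hmA (by omega)
          omega
        · have := hAsep.2.2 a (Finset.mem_of_mem_erase ha) b (Finset.mem_of_mem_erase hb) hab
          omega
    have hB : insert n (A.erase (n - 1)) ∈ sepSets n k r := by
      refine mem_sep.2 ⟨hBsep, ?_⟩
      rw [Finset.card_insert_of_notMem hnA', Finset.card_erase_of_mem hmA]
      omega
    have hBE := hE2 _ hB ⟨hBsep, n, nB, by omega, Or.inl rfl⟩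
      (Finset.mem_insert_of_mem (Finset.mem_erase.2 ⟨by omega, hdA⟩))
    have hBA : (insert n (A.erase (n - 1))).image (phi n) = A := by
      ext x
      rw [mem_image_phi nB (by omega), Finset.mem_insert, Finset.mem_erase]
      constructor
      · rintro (rfl | ⟨rfl | h, h'⟩)
        · exact hmA
        · exact absurd rfl h'
        · exact h.2
      · intro hx
        have : x ≠ n := by rintro rfl; exact hnA hx
        tauto
    rw [Efam, Finset.mem_filter, hBA] at hBE
    have hAF : A ∈ F := by tauto
    by_cases hnS : n ∈ S
    · obtain ⟨y, hy⟩ := hI A hAF S hSF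
      rw [Finset.mem_inter] at hy
      have hyn : y ≠ n := by rintro rfl; exact hnA hy.1
      have h1 := hAU y hy.1 (toU y hy.2 hyn)
      have := hSsep.2.2 y hy.2 n hnS (by omega)
      omega
    · obtain ⟨y, hy⟩ := hI _ hBE.1 S hSF
      rw [Finset.mem_inter, Finset.mem_insert, Finset.mem_erase] at hy
      have hyn : y ≠ n := by rintro rfl; exact hnS hy.2
      have h2 : y ≠ n - 1 ∧ y ∈ A := by tauto
      exact h2.1 (hAU y h2.2 (toU y hy.2 hyn))
  by_cases hmT : n - 1 ∈ T
  · exact finG T hT hdT hmT fun x hx hxU => absurd hxU (hTU x hx)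
  have hTne : T.Nonempty := ⟨d, hdT⟩
  obtain ⟨a, haT, hamin⟩ : ∃ a ∈ T, ∀ x ∈ T, a ≤ x :=
    ⟨T.min' hTne, T.min'_mem hTne, fun x hx => T.min'_le x hx⟩
  obtain ⟨b, hbT, hbmax⟩ : ∃ b ∈ T, ∀ x ∈ T, x ≤ b :=
    ⟨T.max' hTne, T.max'_mem hTne, fun x hx => T.le_max' x hx⟩
  have hab : a < b := by
    obtain ⟨x, hx, y, hy, hxy⟩ := Finset.one_lt_card.1 (show 1 < T.card by omega)
    have := hamin x hx
    have := hamin y hy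
    have := hbmax x hx
    have := hbmax y hy
    omega
  have hab' := hTsep.2.2 a haT b hbT hab
  have ha1 := hTsep.1 a haT
  have hb1 := hTsep.1 b hbT
  have hbm : b ≠ n - 1 := by rintro rfl; exact hmT hbT
  -- replacing one element by the merged point
  have repl : ∀ c ∈ T, c ≠ d → (∀ x ∈ T, x ≠ c → k < x ∧ x + k < n - 1) → False := by
    intro c hc hcd hcl
    have hmT' : n - 1 ∉ T.erase c := fun h => hmT (Finset.mem_of_mem_erase h)
    refine finG (insert (n - 1) (T.erase c)) (mem_sep.2 ⟨⟨?_, by omega, ?_⟩, ?_⟩) ?_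
      (Finset.mem_insert_self _ _) ?_
    · intro x hx
      rcases Finset.mem_insert.1 hx with rfl | hx
      · omega
      · exact hTsep.1 x (Finset.mem_of_mem_erase hx)
    · intro x hx y hy hxy
      rcases Finset.mem_insert.1 hx with rfl | hx <;> rcases Finset.mem_insert.1 hy with rfl | hy
      · omega
      · have := hTsep.1 y (Finset.mem_of_mem_erase hy); omega
      · rw [Finset.mem_erase] at hx
        have := hcl x hx.2 hx.1
        omega
      · exact hTsep.2.2 x (Finset.mem_of_mem_erase hx) y (Finset.mem_of_mem_erase hy) hxy
    · rw [Finset.card_insert_of_notMem hmT', Finset.card_erase_of_mem hc]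
      omega
    · exact Finset.mem_insert_of_mem (Finset.mem_erase.2 ⟨hcd.symm, hdT⟩)
    · intro x hx hxU
      rcases Finset.mem_insert.1 hx with rfl | hx
      · rfl
      · exact absurd hxU (hTU x (Finset.mem_of_mem_erase hx))
  by_cases hr1 : b ≠ d ∧ k < a
  · refine repl b hbT hr1.1 fun x hx hxb => ?_
    have := hamin x hx
    have := hbmax x hx
    have := hTsep.2.2 x hx b hbT (by omega)
    omega
  by_cases hr2 : a ≠ d ∧ b + k < n - 1
  · refine repl a haT hr2.1 fun x hx hxb => ?_
    have := hamin x hx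
    have := hbmax x hx
    have := hTsep.2.2 a haT x hx (by omega)
    omega
  have had : a ≠ d := by
    rintro rfl
    exact hr1 ⟨by omega, by omega⟩
  have hbd : b ≠ d := by
    rintro rfl
    exact hr2 ⟨by omega, by omega⟩
  have hak : a ≤ k := by
    by_contra h
    exact hr1 ⟨hbd, by omega⟩
  have hbk : n - 1 ≤ b + k := by
    by_contra h
    exact hr2 ⟨had, by omega⟩
  obtain ⟨i, hik, hia, hib, hi1, hi2, hi3⟩ := choose_gap hk hUsep (a := a) (b := b) (by omega)
    ⟨ha1.1, hak⟩ ⟨hbk, by omega⟩ hab'.2 (hTU a haT) (hTU b hbT)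
  obtain ⟨v, hv⟩ : ∃ v, (i < k ∧ v = k - i) ∨ (i = k ∧ v = n) := by
    rcases Nat.lt_or_ge i k with h | h
    · exact ⟨_, Or.inl ⟨h, rfl⟩⟩
    · exact ⟨_, Or.inr ⟨by omega, rfl⟩⟩
  set M := (T.erase a).erase b with hM
  have hmid : ∀ x ∈ M, x ∈ T ∧ a + k < x ∧ x + k < b := by
    intro x hx
    rw [hM, Finset.mem_erase, Finset.mem_erase] at hx
    obtain ⟨h1, h2, h3⟩ := hx
    have := hamin x h3
    have := hbmax x h3
    have := hTsep.2.2 a haT x h3 (by omega)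
    have := hTsep.2.2 x h3 b hbT (by omega)
    exact ⟨h3, by omega, by omega⟩
  have hMc : M.card = r - 2 := by
    rw [hM, Finset.card_erase_of_mem (Finset.mem_erase.2 ⟨by omega, hbT⟩),
      Finset.card_erase_of_mem haT]
    omega
  have hdM : d ∈ M := by
    rw [hM, Finset.mem_erase, Finset.mem_erase]; exact ⟨hbd.symm, had.symm, hdT⟩
  have hvM : v ∉ M := by
    intro h; have := hmid v h; omega
  have huM : n - 1 - i ∉ insert v M := by
    rw [Finset.mem_insert]
    rintro (h | h)
    · omega
    · have := hmid _ h; omega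
  have hBsep : Sep n k (insert (n - 1 - i) (insert v M)) := by
    refine ⟨?_, by omega, ?_⟩
    · intro x hx
      rw [Finset.mem_insert, Finset.mem_insert] at hx
      rcases hx with rfl | rfl | hx
      · omega
      · omega
      · have := hmid x hx; omega
    · intro x hx y hy hxy
      rw [Finset.mem_insert, Finset.mem_insert] at hx hy
      rcases hx with rfl | rfl | hx <;> rcases hy with rfl | rfl | hy
      · omega
      · omega
      · have := hmid y hy; omega
      · omega
      · omega
      · have := hmid y hy; omega
      · have := hmid x hx; omega
      · have := hmid x hx; omega
      · have := hTsep.2.2 x (hmid x hx).1 y (hmid y hy).1 hxy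
        omega
  have hB : insert (n - 1 - i) (insert v M) ∈ sepSets n k r := by
    refine mem_sep.2 ⟨hBsep, ?_⟩
    rw [Finset.card_insert_of_notMem huM, Finset.card_insert_of_notMem hvM, hMc]
    omega
  have hQ : Q n k (insert (n - 1 - i) (insert v M)) := by
    refine ⟨hBsep, ?_⟩
    rcases hv with hv | hv
    · exact ⟨n - 1 - i, by simp, by omega, Or.inr ⟨v, by simp, by omega, by omega⟩⟩
    · exact ⟨v, by simp, by omega, Or.inl hv.2⟩
  have hBE := hE2 _ hB hQ (by simp [hdM])
  obtain ⟨y, hy⟩ := hI _ (Finset.mem_of_mem_filter _ hBE) S hSF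
  rw [Finset.mem_inter, Finset.mem_insert, Finset.mem_insert] at hy
  obtain ⟨hy1, hyS⟩ := hy
  by_cases hyn : y = n
  · subst hyn
    have h1 := toU' hyS
    rcases hy1 with h | h | h
    · omega
    · have : i = k := by omega
      exact hi3 this h1
    · have := hmid y h; omega
  · have h1 := toU y hyS hyn
    rcases hy1 with rfl | rfl | h
    · exact hi1 h1
    · rcases hv with hv | hv
      · rw [hv.2] at h1; exact hi2 hv.1 h1
      · exact hyn hv.2
    · exact hTU y (hmid y h).1 h1

/-- All separated sets containing `a` and its rotation by `k + 1` lie in `F`. -/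
def PairIn (n k r : ℕ) (F : Finset (Finset ℕ)) (a : ℕ) : Prop :=
  ∀ B ∈ sepSets n k r, a ∈ B → rot n (k + 1) a ∈ B → B ∈ F

/-- Statement of uniqueness (existence of a common point). -/
def Uniq (n k r : ℕ) : Prop :=
  ∀ F : Finset (Finset ℕ), F ⊆ sepSets n k r → Intersecting F →
    F.card = (n - k * r - 1).choose (r - 1) → ∃ x ∈ Finset.Icc 1 n, ∀ A ∈ F, x ∈ A

lemma star_of_common {n k r x : ℕ} (hk : 1 ≤ k) (hr : 1 ≤ r) {F : Finset (Finset ℕ)}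
    (hF : F ⊆ sepSets n k r) (hc : F.card = (n - k * r - 1).choose (r - 1))
    (hx : ∀ A ∈ F, x ∈ A) : F = (sepSets n k r).filter fun A => x ∈ A := by
  apply Finset.eq_of_subset_of_card_le
  · intro A hA
    exact Finset.mem_filter.2 ⟨hF hA, hx A hA⟩
  · rw [hc]
    apply upper k hk n r hr _ (Finset.filter_subset _ _)
    intro A hA B hB
    exact ⟨x, Finset.mem_inter.2 ⟨(Finset.mem_filter.1 hA).2, (Finset.mem_filter.1 hB).2⟩⟩

lemma main_step {n k r : ℕ} (hk : 2 ≤ k) (hr : 2 ≤ r) (hn : (k + 1) * r + 1 ≤ n)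
    (ih : Uniq (n - k - 1) k (r - 1)) {F : Finset (Finset ℕ)}
    (hF : F ⊆ sepSets n k r) (hI : Intersecting F)
    (hc : F.card = (n - k * r - 1).choose (r - 1)) :
    (∃ x ∈ Finset.Icc 1 n, ∀ A ∈ F, x ∈ A) ∨
    (∃ a, n - 1 - k ≤ a ∧ a ≤ n - 1 ∧ PairIn n k r F a) := by
  have hn2 : 2 * k + 3 ≤ n := by nlinarith
  have hn3 : 2 * k + 2 ≤ n := by omega
  have hk1 : 1 ≤ k := by omega
  have hEc : ((Efam n k r F).image (g n k)).card =
      (n - k - 1 - k * (r - 1) - 1).choose (r - 1 - 1) := by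
    have h1 := upper k hk1 (n - 1) r (by omega) _
      (phi_subset (n := n) (k := k) (r := r) (F := F)) (phi_inter hI)
    have h2 := upper k hk1 (n - k - 1) (r - 1) (by omega) _ (g_subset hn3 hk1 hF)
      (g_inter hn3 hk1 hF hI)
    rw [phi_card hk1 (by omega) hF] at h1
    rw [g_card hn3 hk1 hF] at h2 ⊢
    rw [split_card (n := n) (k := k) (r := r) F] at hc
    obtain ⟨s, rfl⟩ : ∃ s, r = s + 2 := ⟨r - 2, by omega⟩
    obtain ⟨N, hN⟩ : ∃ N, n - k * (s + 2) - 1 = N + 1 := ⟨n - k * (s + 2) - 1 - 1, by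
      have : (k + 1) * (s + 2) = k * (s + 2) + s + 2 := by ring
      omega⟩
    have e1 : n - 1 - k * (s + 2) - 1 = N := by omega
    have e2 : n - k - 1 - k * (s + 2 - 1) - 1 = N := by
      have : k * (s + 2) = k * (s + 2 - 1) + k := by
        rw [show s + 2 - 1 = s + 1 by omega]; ring
      omega
    rw [e1] at h1
    rw [e2] at h2 ⊢
    rw [hN] at hc
    simp only [show s + 2 - 1 = s + 1 by omega, show s + 1 - 1 = s by omega] at h1 h2 hc ⊢
    rw [Nat.choose_succ_succ, Nat.succ_eq_add_one] at hc
    omega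
  obtain ⟨d, hd, hdA⟩ := ih _ (g_subset hn3 hk1 hF) (g_inter hn3 hk1 hF hI) hEc
  have hstar := star_of_common hk1 (by omega) (g_subset hn3 hk1 hF) hEc hdA
  rw [Finset.mem_Icc] at hd
  have hE1 : ∀ A ∈ Efam n k r F, d ∈ A := by
    intro A hA
    exact (mem_g.1 (hdA _ (Finset.mem_image_of_mem _ hA))).1
  have hE2 : ∀ B ∈ sepSets n k r, Q n k B → d ∈ B → B ∈ Efam n k r F := by
    intro B hB hQ hdB
    have h1 : g n k B ∈ (Efam n k r F).image (g n k) := by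
      rw [hstar, Finset.mem_filter]
      exact ⟨Q_mem hn3 hQ (mem_sep.1 hB).2, mem_g.2 ⟨hdB, by omega⟩⟩
    obtain ⟨A, hA, hAB⟩ := Finset.mem_image.1 h1
    rw [← Q_inj hn3 (Efam_Q hn3 hk1 hF hA) hQ hAB]
    exact hA
  have hEF : ∀ B ∈ Efam n k r F, B ∈ F := fun B hB => Finset.mem_of_mem_filter _ hB
  by_cases h1 : d ≤ k
  · right
    refine ⟨n - 1 - k + d, by omega, by omega, ?_⟩
    intro B hB ha hb
    have e : rot n (k + 1) (n - 1 - k + d) = d := by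
      rcases rot_cases n (k + 1) (n - 1 - k + d) with h | h <;> omega
    rw [e] at hb
    exact hEF _ (hE2 B hB ⟨(mem_sep.1 hB).1, _, ha, by omega, Or.inr ⟨d, hb, h1, by omega⟩⟩ hb)
  by_cases h2 : d = n - k - 1
  · right
    refine ⟨d, by omega, by omega, ?_⟩
    intro B hB ha hb
    have e : rot n (k + 1) d = n := by
      rcases rot_cases n (k + 1) d with h | h <;> omega
    rw [e] at hb
    exact hEF _ (hE2 B hB ⟨(mem_sep.1 hB).1, _, hb, by omega, Or.inl rfl⟩ ha)
  · left
    exact ⟨d, Finset.mem_Icc.2 (by omega),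
      nonwindow hk hr hn2 hF hI ⟨by omega, by omega⟩ hE1 hE2⟩

/-- Rotated family. -/
def rotF (n t : ℕ) (F : Finset (Finset ℕ)) : Finset (Finset ℕ) :=
  F.image fun A => A.image (rot n t)

lemma image_rot_inj {n k l t : ℕ} {A B : Finset ℕ} (hA : Sep n k A) (hB : Sep n l B)
    (h : A.image (rot n t) = B.image (rot n t)) : A ⊆ B := by
  intro x hx
  have h1 : rot n t x ∈ B.image (rot n t) := h ▸ Finset.mem_image_of_mem _ hx
  obtain ⟨y, hy, hxy⟩ := Finset.mem_image.1 h1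
  rw [← rot_inj (hB.1 y hy) (hA.1 x hx) hxy]
  exact hy

lemma image_rot_eq {n k t : ℕ} {A B : Finset ℕ} (hA : Sep n k A) (hB : Sep n k B)
    (h : A.image (rot n t) = B.image (rot n t)) : A = B :=
  Finset.Subset.antisymm (image_rot_inj hA hB h) (image_rot_inj hB hA h.symm)

lemma rotF_sub {n k r t : ℕ} (ht : t ≤ n) {F : Finset (Finset ℕ)} (hF : F ⊆ sepSets n k r) :
    rotF n t F ⊆ sepSets n k r := by
  intro A' hA'
  obtain ⟨A, hA, rfl⟩ := Finset.mem_image.1 hA'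
  exact rot_mem ht (hF hA)

lemma rotF_inter {n t : ℕ} {F : Finset (Finset ℕ)} (hI : Intersecting F) :
    Intersecting (rotF n t F) := by
  intro A' hA' B' hB'
  obtain ⟨A, hA, rfl⟩ := Finset.mem_image.1 hA'
  obtain ⟨B, hB, rfl⟩ := Finset.mem_image.1 hB'
  obtain ⟨x, hx⟩ := hI A hA B hB
  rw [Finset.mem_inter] at hx
  exact ⟨rot n t x, Finset.mem_inter.2
    ⟨Finset.mem_image_of_mem _ hx.1, Finset.mem_image_of_mem _ hx.2⟩⟩

lemma rotF_card {n k r t : ℕ} {F : Finset (Finset ℕ)} (hF : F ⊆ sepSets n k r) :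
    (rotF n t F).card = F.card := by
  apply Finset.card_image_of_injOn
  intro A hA B hB h
  exact image_rot_eq (mem_sep.1 (hF hA)).1 (mem_sep.1 (hF hB)).1 h

lemma mem_of_rotF {n k r t : ℕ} {F : Finset (Finset ℕ)} (hF : F ⊆ sepSets n k r)
    {B : Finset ℕ} (hB : B ∈ sepSets n k r) (h : B.image (rot n t) ∈ rotF n t F) : B ∈ F := by
  obtain ⟨A, hA, hAB⟩ := Finset.mem_image.1 h
  rw [← image_rot_eq (mem_sep.1 (hF hA)).1 (mem_sep.1 hB).1 hAB]
  exact hA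

lemma rot_surj {n t y : ℕ} (ht : t ≤ n) (hy : 1 ≤ y ∧ y ≤ n) :
    ∃ x, 1 ≤ x ∧ x ≤ n ∧ rot n t x = y := by
  by_cases h : t < y
  · refine ⟨y - t, by omega, by omega, ?_⟩
    rcases rot_cases n t (y - t) with h' | h' <;> omega
  · refine ⟨y + n - t, by omega, by omega, ?_⟩
    rcases rot_cases n t (y + n - t) with h' | h' <;> omega

lemma common_of_rotF {n k r t : ℕ} (ht : t ≤ n) {F : Finset (Finset ℕ)} (hF : F ⊆ sepSets n k r)
    (h : ∃ x ∈ Finset.Icc 1 n, ∀ A ∈ rotF n t F, x ∈ A) :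
    ∃ x ∈ Finset.Icc 1 n, ∀ A ∈ F, x ∈ A := by
  obtain ⟨y, hy, hyA⟩ := h
  obtain ⟨x, hx1, hx2, rfl⟩ := rot_surj ht (Finset.mem_Icc.1 hy)
  refine ⟨x, Finset.mem_Icc.2 ⟨hx1, hx2⟩, fun A hA => ?_⟩
  have h1 := hyA _ (Finset.mem_image_of_mem _ hA)
  obtain ⟨z, hz, hzx⟩ := Finset.mem_image.1 h1
  rw [← rot_inj ((mem_sep.1 (hF hA)).1.1 z hz) ⟨hx1, hx2⟩ hzx]
  exact hz

lemma pair_of_rotF {n k r t a : ℕ} (ht : t ≤ n) (hkn : k + 1 ≤ n) {F : Finset (Finset ℕ)}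
    (hF : F ⊆ sepSets n k r) (ha : 1 ≤ a ∧ a ≤ n) (h : PairIn n k r (rotF n t F) (rot n t a)) :
    PairIn n k r F a := by
  intro B hB h1 h2
  apply mem_of_rotF hF hB (t := t)
  apply h _ (rot_mem ht hB) (Finset.mem_image_of_mem _ h1)
  have e : rot n (k + 1) (rot n t a) = rot n t (rot n (k + 1) a) := by
    rcases rot_cases n t a with p | p <;> rcases rot_cases n (k + 1) a with q | q <;>
      rcases rot_cases n (k + 1) (rot n t a) with u | u <;>
      rcases rot_cases n t (rot n (k + 1) a) with v | v <;> omega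
  rw [e]
  exact Finset.mem_image_of_mem _ h2

lemma pair_rotF {n k r t a : ℕ} (ht : t ≤ n) (hkn : k + 1 ≤ n) {F : Finset (Finset ℕ)}
    (hF : F ⊆ sepSets n k r) (ha : 1 ≤ a ∧ a ≤ n) (h : PairIn n k r F a) :
    PairIn n k r (rotF n t F) (rot n t a) := by
  intro B hB h1 h2
  -- rotate back
  have back : ∀ x, 1 ≤ x ∧ x ≤ n → rot n t (rot n (n - t) x) = x := by
    intro x hx
    rcases rot_cases n (n - t) x with p | p <;>
      rcases rot_cases n t (rot n (n - t) x) with q | q <;> omega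
  have hBs := (mem_sep.1 hB).1
  have hB' : (B.image (rot n (n - t))).image (rot n t) = B := by
    ext x
    simp only [Finset.mem_image]
    constructor
    · rintro ⟨y, ⟨z, hz, rfl⟩, rfl⟩
      rw [back z (hBs.1 z hz)]; exact hz
    · intro hx
      exact ⟨_, ⟨x, hx, rfl⟩, back x (hBs.1 x hx)⟩
  rw [← hB']
  apply Finset.mem_image_of_mem (fun A => Finset.image (rot n t) A)
  apply h _ (rot_mem (by omega) hB)
  · refine Finset.mem_image.2 ⟨_, h1, ?_⟩
    rcases rot_cases n t a with p | p <;>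
      rcases rot_cases n (n - t) (rot n t a) with q | q <;> omega
  · refine Finset.mem_image.2 ⟨_, h2, ?_⟩
    rcases rot_cases n t a with p | p <;>
      rcases rot_cases n (k + 1) a with q | q <;>
      rcases rot_cases n (k + 1) (rot n t a) with u | u <;>
      rcases rot_cases n (n - t) (rot n (k + 1) (rot n t a)) with v | v <;> omega

/-- A nearly arithmetic progression. -/
def prog (k r : ℕ) (e : ℕ → ℕ) : Finset ℕ := (Finset.range r).image fun j => j * (k + 1) + e j

lemma mul_gap {k i j : ℕ} (h : i < j) : i * (k + 1) + (k + 1) ≤ j * (k + 1) := by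
  have : (i + 1) * (k + 1) ≤ j * (k + 1) := Nat.mul_le_mul_right _ h
  linarith

lemma prog_mem {n k r : ℕ} (hr : 1 ≤ r) (hn : (k + 1) * r + 1 ≤ n) (e : ℕ → ℕ)
    (h1 : ∀ i < r, 1 ≤ e i ∧ e i ≤ k + 2) (h2 : ∀ i j, i < j → j < r → e i ≤ e j ∧ e j ≤ e i + 1) :
    prog k r e ∈ sepSets n k r := by
  have hn' : r * (k + 1) + 1 ≤ n := by rw [mul_comm]; exact hn
  have mono : ∀ i j, i < j → j < r → i * (k + 1) + e i + k < j * (k + 1) + e j := by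
    intro i j hij hj
    have := h2 i j hij hj
    have := mul_gap (k := k) hij
    omega
  rw [mem_sep]
  refine ⟨⟨?_, ?_, ?_⟩, ?_⟩
  · intro x hx
    obtain ⟨i, hi, rfl⟩ := Finset.mem_image.1 hx
    have hi := Finset.mem_range.1 hi
    have := h1 i hi
    have := mul_gap (k := k) hi
    show 1 ≤ i * (k + 1) + e i ∧ i * (k + 1) + e i ≤ n
    omega
  · have := mul_gap (k := k) (show 0 < r by omega)
    omega
  · intro a ha b hb hab
    obtain ⟨i, hi, rfl⟩ := Finset.mem_image.1 ha
    obtain ⟨j, hj, rfl⟩ := Finset.mem_image.1 hb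
    have hi := Finset.mem_range.1 hi
    have hj := Finset.mem_range.1 hj
    have hij : i < j := by
      rcases lt_trichotomy i j with h | h | h
      · exact h
      · subst h; omega
      · have := mono j i h hi; omega
    have := mono i j hij hj
    have := h2 i j hij hj
    have := mul_gap (k := k) hj
    omega
  · unfold prog
    rw [Finset.card_image_of_injOn, Finset.card_range]
    intro i hi j hj hij
    have hi := Finset.mem_range.1 hi
    have hj := Finset.mem_range.1 hj
    dsimp only at hij
    rcases lt_trichotomy i j with h | h | h
    · have := mono i j h hj; omega
    · exact h
    · have := mono j i h hi; omega

lemma mem_prog {k r : ℕ} (e : ℕ → ℕ) (j x : ℕ) (hj : j < r) (hx : x = j * (k + 1) + e j) :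
    x ∈ prog k r e := Finset.mem_image.2 ⟨j, Finset.mem_range.2 hj, hx.symm⟩

lemma no_two_pairs {n k r a : ℕ} (hk : 2 ≤ k) (hr : 3 ≤ r) (hn : (k + 1) * r + 1 ≤ n)
    {F : Finset (Finset ℕ)} (hI : Intersecting F) (h1 : PairIn n k r F 1)
    (ha1 : k + 3 ≤ a) (ha2 : a ≤ 2 * k + 3) (ha : PairIn n k r F a) : False := by
  have hn3 : (k + 1) * 3 + 1 ≤ n := le_trans (by gcongr) hn
  have r1 : rot n (k + 1) 1 = k + 2 := by
    rcases rot_cases n (k + 1) 1 with h | h <;> omega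
  have ra : rot n (k + 1) a = a + k + 1 := by
    rcases rot_cases n (k + 1) a with h | h <;> omega
  by_cases hy : a ≤ 2 * k + 2
  · have hS : prog k r (fun _ => 1) ∈ F := by
      apply h1 _ (prog_mem (by omega) hn _ (fun i _ => by omega) (fun i j _ _ => by omega))
      · exact mem_prog _ 0 _ (by omega) (by simp)
      · rw [r1]; exact mem_prog _ 1 _ (by omega) (by omega)
    have hS' : prog k r (fun _ => a - (k + 1)) ∈ F := by
      apply ha _ (prog_mem (by omega) hn _ (fun i _ => by omega) (fun i j _ _ => by omega))
      · exact mem_prog _ 1 _ (by omega) (by omega)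
      · rw [ra]; exact mem_prog _ 2 _ (by omega) (by omega)
    obtain ⟨x, hx⟩ := hI _ hS _ hS'
    rw [Finset.mem_inter] at hx
    obtain ⟨i, hi, hxi⟩ := Finset.mem_image.1 hx.1
    obtain ⟨j, hj, hxj⟩ := Finset.mem_image.1 hx.2
    dsimp only at hxi hxj
    rcases lt_trichotomy i j with h | h | h
    · have := mul_gap (k := k) h; omega
    · subst h; omega
    · have := mul_gap (k := k) h; omega
  · have hS : prog k r (fun j => if j < 2 then 1 else 2) ∈ F := by
      apply h1 _ (prog_mem (by omega) hn _ (fun i _ => by split_ifs <;> omega)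
        (fun i j _ _ => by split_ifs <;> omega))
      · exact mem_prog _ 0 _ (by omega) (by simp)
      · rw [r1]; exact mem_prog _ 1 _ (by omega) (by simp)
    have hS' : prog k r (fun j => if j = 0 then k + 1 else k + 2) ∈ F := by
      apply ha _ (prog_mem (by omega) hn _ (fun i _ => by split_ifs <;> omega)
        (fun i j _ _ => by split_ifs <;> omega))
      · exact mem_prog _ 1 _ (by omega) (by simp; omega)
      · rw [ra]; exact mem_prog _ 2 _ (by omega) (by simp; omega)
    obtain ⟨x, hx⟩ := hI _ hS _ hS'
    rw [Finset.mem_inter] at hx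
    obtain ⟨i, hi, hxi⟩ := Finset.mem_image.1 hx.1
    obtain ⟨j, hj, hxj⟩ := Finset.mem_image.1 hx.2
    dsimp only at hxi hxj
    rcases lt_or_ge j i with h | h
    · obtain ⟨d, rfl⟩ : ∃ d, i = j + 1 + d := ⟨i - (j + 1), by omega⟩
      have e : (j + 1 + d) * (k + 1) = j * (k + 1) + (k + 1) + d * (k + 1) := by ring
      rcases Nat.eq_zero_or_pos d with hd | hd
      · subst hd
        split_ifs at hxi hxj <;> omega
      · have := mul_gap (k := k) hd
        split_ifs at hxi hxj <;> omega
    · have : i * (k + 1) ≤ j * (k + 1) := Nat.mul_le_mul_right _ h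
      split_ifs at hxi hxj <;> omega

lemma uniq_two {n k : ℕ} (hk : 2 ≤ k) (hn : 2 * k + 3 ≤ n) : Uniq n k 2 := by
  intro F hF hI hc
  have hc' : F.card = n - k * 2 - 1 := by rw [hc]; simp
  by_contra hno
  push Not at hno
  obtain ⟨A, hA⟩ : F.Nonempty := Finset.card_pos.1 (by omega)
  have hAs := mem_sep.1 (hF hA)
  obtain ⟨x, y, hxy, rfl⟩ := Finset.card_eq_two.1 hAs.2
  have hx := hAs.1.1 x (by simp)
  have hy := hAs.1.1 y (by simp)
  obtain ⟨B, hB, hxB⟩ := hno x (Finset.mem_Icc.2 hx)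
  obtain ⟨C, hC, hyC⟩ := hno y (Finset.mem_Icc.2 hy)
  have pairOf : ∀ D ∈ F, ∀ p ∈ D, ∃ q, q ≠ p ∧ D = {p, q} := by
    intro D hD p hp
    obtain ⟨u, v, huv, rfl⟩ := Finset.card_eq_two.1 (mem_sep.1 (hF hD)).2
    simp only [Finset.mem_insert, Finset.mem_singleton] at hp
    rcases hp with rfl | rfl
    · exact ⟨v, huv.symm, rfl⟩
    · exact ⟨u, huv, Finset.pair_comm _ _⟩
  have hyB : y ∈ B := by
    obtain ⟨w, hw⟩ := hI _ hA _ hB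
    simp only [Finset.mem_inter, Finset.mem_insert, Finset.mem_singleton] at hw
    rcases hw with ⟨rfl | rfl, h⟩
    · exact absurd h hxB
    · exact h
  have hxC : x ∈ C := by
    obtain ⟨w, hw⟩ := hI _ hA _ hC
    simp only [Finset.mem_inter, Finset.mem_insert, Finset.mem_singleton] at hw
    rcases hw with ⟨rfl | rfl, h⟩
    · exact h
    · exact absurd h hyC
  obtain ⟨z, hzy, rfl⟩ := pairOf B hB y hyB
  obtain ⟨z', hzx, rfl⟩ := pairOf C hC x hxC
  simp only [Finset.mem_insert, Finset.mem_singleton, not_or] at hxB hyC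
  have hzz : z' = z := by
    obtain ⟨w, hw⟩ := hI _ hB _ hC
    simp only [Finset.mem_inter, Finset.mem_insert, Finset.mem_singleton] at hw
    omega
  subst hzz
  have hsub : F ⊆ {{x, y}, {y, z'}, {x, z'}} := by
    intro D hD
    obtain ⟨u, hu⟩ := hI _ hD _ hA
    obtain ⟨v, hv⟩ := hI _ hD _ hB
    obtain ⟨w, hw⟩ := hI _ hD _ hC
    simp only [Finset.mem_inter, Finset.mem_insert, Finset.mem_singleton] at hu hv hw
    have two : ∀ p ∈ D, ∀ q ∈ D, p ≠ q → D = {p, q} := by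
      intro p hp q hq hpq
      obtain ⟨q', h1, h2⟩ := pairOf D hD p hp
      rw [h2] at hq ⊢
      simp only [Finset.mem_insert, Finset.mem_singleton] at hq
      rcases hq with h | h
      · exact absurd h.symm hpq
      · rw [h]
    simp only [Finset.mem_insert, Finset.mem_singleton]
    by_cases h1 : x ∈ D
    · by_cases h2 : y ∈ D
      · exact Or.inl (two x h1 y h2 hxy)
      · have h3 : z' ∈ D := by
          rcases hv with ⟨h, rfl | rfl⟩
          · exact absurd h h2
          · exact h
        exact Or.inr (Or.inr (two x h1 z' h3 hzx.symm))
    · have h2 : y ∈ D := by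
        rcases hu with ⟨h, rfl | rfl⟩
        · exact absurd h h1
        · exact h
      have h3 : z' ∈ D := by
        rcases hw with ⟨h, rfl | rfl⟩
        · exact absurd h h1
        · exact h
      exact Or.inr (Or.inl (two y h2 z' h3 hzy.symm))
  have h3 : F.card ≤ 3 := le_trans (Finset.card_le_card hsub) Finset.card_le_three
  have sA := hAs.1.2.2
  have sB := (mem_sep.1 (hF hB)).1.2.2
  have sC := (mem_sep.1 (hF hC)).1.2.2
  have a1 := sA x (by simp) y (by simp)
  have a2 := sA y (by simp) x (by simp)
  have b1 := sB y (by simp) z' (by simp)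
  have b2 := sB z' (by simp) y (by simp)
  have c1 := sC x (by simp) z' (by simp)
  have c2 := sC z' (by simp) x (by simp)
  omega

lemma uniq_of_one {n k r : ℕ} (hr : 1 ≤ r) {F : Finset (Finset ℕ)} (hF : F ⊆ sepSets n k r)
    (hc : F.card = 1) : ∃ x ∈ Finset.Icc 1 n, ∀ A ∈ F, x ∈ A := by
  obtain ⟨A, rfl⟩ := Finset.card_eq_one.1 hc
  have hA := mem_sep.1 (hF (Finset.mem_singleton_self A))
  obtain ⟨x, hx⟩ : A.Nonempty := Finset.card_pos.1 (by omega)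
  refine ⟨x, Finset.mem_Icc.2 (hA.1.1 x hx), fun B hB => ?_⟩
  rw [Finset.mem_singleton.1 hB]
  exact hx

lemma uniq_all {k : ℕ} (hk : 2 ≤ k) : ∀ r, 1 ≤ r → ∀ n, (k + 1) * r ≤ n → Uniq n k r := by
  intro r hr
  induction r, hr using Nat.le_induction with
  | base =>
    intro n hn F hF hI hc
    exact uniq_of_one le_rfl hF (by rw [hc]; simp)
  | succ r hr ih =>
    intro n hn
    rcases Nat.eq_or_lt_of_le hn with h | hn1
    · intro F hF hI hc
      refine uniq_of_one (by omega) hF ?_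
      rw [hc]
      have : n - k * (r + 1) - 1 = r + 1 - 1 := by
        have e : (k + 1) * (r + 1) = k * (r + 1) + (r + 1) := by ring
        omega
      rw [this, Nat.choose_self]
    · rcases Nat.eq_or_lt_of_le hr with h1 | h1
      · subst h1
        exact uniq_two hk (by omega)
      · intro F hF hI hc
        have hn3 : (k + 1) * 3 ≤ (k + 1) * (r + 1) := Nat.mul_le_mul_left _ (by omega)
        have ih' : Uniq (n - k - 1) k (r + 1 - 1) := by
          apply ih
          have e : (k + 1) * (r + 1) = (k + 1) * r + (k + 1) := by ring
          omega
        rcases main_step hk (by omega) hn1 ih' hF hI hc with hl | ⟨a, ha1, ha2, hP⟩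
        · exact hl
        have ht : n + 1 - a ≤ n := by omega
        have hs : n - 1 - (2 * k + 3) ≤ n := by omega
        have hkn : k + 1 ≤ n := by omega
        have hB := rotF_sub ht hF
        have hP1 := pair_rotF ht hkn hF (by omega) hP
        have e1 : rot n (n + 1 - a) a = 1 := by
          rcases rot_cases n (n + 1 - a) a with h | h <;> omega
        rw [e1] at hP1
        have hBI : Intersecting (rotF n (n + 1 - a) F) := rotF_inter hI
        have hC := rotF_sub hs hB
        have hCI : Intersecting (rotF n (n - 1 - (2 * k + 3)) (rotF n (n + 1 - a) F)) :=
          rotF_inter hBI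
        have hCc : (rotF n (n - 1 - (2 * k + 3)) (rotF n (n + 1 - a) F)).card =
            (n - k * (r + 1) - 1).choose (r + 1 - 1) := by
          rw [rotF_card hB, rotF_card hF, hc]
        rcases main_step hk (by omega) hn1 ih' hC hCI hCc with hl | ⟨b, hb1, hb2, hQ⟩
        · exact common_of_rotF ht hF (common_of_rotF hs hB hl)
        exfalso
        have e2 : rot n (n - 1 - (2 * k + 3)) (b - (n - 1 - (2 * k + 3))) = b := by
          rcases rot_cases n (n - 1 - (2 * k + 3)) (b - (n - 1 - (2 * k + 3))) with h | h <;> omega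
        rw [← e2] at hQ
        exact no_two_pairs hk (by omega) hn1 hBI hP1 (by omega) (by omega)
          (pair_of_rotF hs hkn hB (by omega) hQ)

end SepFam

theorem stmt4 (n k r : ℕ) (hk : 2 ≤ k) (hr : 1 ≤ r) (hn : (k + 1) * r ≤ n)
    (𝒜 : Finset (Finset ℕ)) (h𝒜 : 𝒜 ⊆ sepSets n k r) (hint : Intersecting 𝒜)
    (hcard : 𝒜.card = (n - k * r - 1).choose (r - 1)) :
    ∃ i ∈ Finset.Icc 1 n, 𝒜 = (sepSets n k r).filter fun A => i ∈ A := by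
  obtain ⟨x, hx, h⟩ := SepFam.uniq_all hk r hr n hn 𝒜 h𝒜 hint hcard
  exact ⟨x, hx, SepFam.star_of_common (by omega) hr h𝒜 hcard h⟩
end

section
/- Let n, k, r be positive integers with n ≥ 2(k+1)r, and let 𝒜 ⊆ [n]^(r)_k be an intersecting family of k-separated r-subsets of [n]. Then w(𝒜) ≤ binomial(n−1, (k+1)r−1), and this upper bound equals w({A ∈ [n]^(r)_k : 1 ∈ A}). -/
/-- The circular successor of `a` in `A ⊆ [n]`: the least element of `A` above `a`,
or (wrapping around) the least element of `A` plus `n`. -/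
def circSucc (n : ℕ) (A : Finset ℕ) (a : ℕ) : ℕ :=
  if h : (A.filter fun b => a < b).Nonempty then (A.filter fun b => a < b).min' h
  else if h2 : A.Nonempty then A.min' h2 + n
  else 0

/-- The weight of a `k`-separated set: the product over the circular gaps of
`(gap size - 1).choose k`. -/
def weight (n k : ℕ) (A : Finset ℕ) : ℕ :=
  ∏ a ∈ A, (circSucc n A a - a - 1).choose k

/-- the number of elements of `B` below `y` -/
def rk (B : Finset ℕ) (y : ℕ) : ℕ := (B.filter (fun b => b < y)).card

/-- the circular gap after `a` -/
def gapS (n : ℕ) (A : Finset ℕ) (a : ℕ) : Finset ℕ :=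
  (Finset.Icc 1 n).filter fun y => (a < y ∧ y < circSucc n A a) ∨ y + n < circSucc n A a

/-- the sets `B` obtained by adding `k` elements in every gap of `A` -/
def fib (n k : ℕ) (A : Finset ℕ) : Finset (Finset ℕ) :=
  (Finset.Icc 1 n).powerset.filter fun B => A ⊆ B ∧ ∀ a ∈ A, (B ∩ gapS n A a).card = k

theorem circSucc_cases (n : ℕ) (A : Finset ℕ) (a : ℕ) (ha : a ∈ A) :
    (circSucc n A a ∈ A ∧ a < circSucc n A a ∧ ∀ b ∈ A, a < b → circSucc n A a ≤ b) ∨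
    ((∀ b ∈ A, b ≤ a) ∧ ∃ m ∈ A, (∀ b ∈ A, m ≤ b) ∧ circSucc n A a = m + n) := by
  unfold circSucc
  split_ifs with h h2
  · left
    have h1 := Finset.min'_mem _ h
    rw [Finset.mem_filter] at h1
    refine ⟨h1.1, h1.2, fun b hb hab => Finset.min'_le _ _ (by simp [hb, hab])⟩
  · right
    refine ⟨fun b hb => ?_, A.min' h2, Finset.min'_mem _ _, fun b hb => Finset.min'_le _ _ hb, rfl⟩
    by_contra hlt
    exact h ⟨b, by simp [hb]; omega⟩
  · exact absurd ⟨a, ha⟩ h2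

theorem gapS_card (n : ℕ) (A : Finset ℕ) (hA : A ⊆ Finset.Icc 1 n) (a : ℕ) (ha : a ∈ A) :
    (gapS n A a).card = circSucc n A a - a - 1 := by
  have hA' : ∀ b ∈ A, 1 ≤ b ∧ b ≤ n := fun b hb => by simpa using hA hb
  have ha' := hA' a ha
  rw [← Nat.card_Ioo]
  refine Finset.card_bij' (fun y _ => if a < y then y else y + n)
    (fun y _ => if y ≤ n then y else y - n) ?_ ?_ ?_ ?_
  all_goals
    rcases circSucc_cases n A a ha with ⟨h1, h2, h3⟩ | ⟨h1, m, h2, h3, h4⟩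
    · have := hA' _ h1
      intro y hy
      simp only [gapS, Finset.mem_filter, Finset.mem_Icc, Finset.mem_Ioo] at hy ⊢
      split_ifs <;> omega
    · have := hA' _ h2
      have := h3 a ha
      intro y hy
      simp only [gapS, Finset.mem_filter, Finset.mem_Icc, Finset.mem_Ioo] at hy ⊢
      split_ifs <;> omega

theorem gapS_disj (n : ℕ) (A : Finset ℕ) (hA : A ⊆ Finset.Icc 1 n) (a b y : ℕ) (ha : a ∈ A)
    (hb : b ∈ A) (hy : y ∈ gapS n A a) (hy' : y ∈ gapS n A b) : a = b := by
  have hA' : ∀ b ∈ A, 1 ≤ b ∧ b ≤ n := fun b hb => by simpa using hA hb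
  simp only [gapS, Finset.mem_filter, Finset.mem_Icc] at hy hy'
  have := hA' a ha
  have := hA' b hb
  rcases circSucc_cases n A a ha with ⟨h1, h2, h3⟩ | ⟨h1, m, h2, h3, h4⟩ <;>
  rcases circSucc_cases n A b hb with ⟨g1, g2, g3⟩ | ⟨g1, m', g2, g3, g4⟩
  · have := hA' _ h1
    have := hA' _ g1
    have := h3 b hb
    have := g3 a ha
    omega
  · have := hA' _ h1
    have := h3 b hb
    have := g1 a ha
    have := g3 a ha
    omega
  · have := hA' _ g1
    have := g3 a ha
    have := h1 b hb
    have := h3 b hb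
    omega
  · have := h1 b hb
    have := g1 a ha
    omega

theorem gapS_notMem (n : ℕ) (A : Finset ℕ) (hA : A ⊆ Finset.Icc 1 n) (a y : ℕ) (ha : a ∈ A)
    (hy : y ∈ gapS n A a) : y ∉ A := by
  intro hyA
  have hA' : ∀ b ∈ A, 1 ≤ b ∧ b ≤ n := fun b hb => by simpa using hA hb
  simp only [gapS, Finset.mem_filter, Finset.mem_Icc] at hy
  rcases circSucc_cases n A a ha with ⟨h1, h2, h3⟩ | ⟨h1, m, h2, h3, h4⟩
  · have := h3 y hyA
    have := hA' _ h1
    omega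
  · have := h1 y hyA
    have := h3 y hyA
    omega

theorem exists_pred (A : Finset ℕ) (y a : ℕ) (ha : a ∈ A) (hay : a < y) :
    ∃ p ∈ A, p < y ∧ ∀ b ∈ A, b < y → b ≤ p := by
  have h : (A.filter (fun b => b < y)).Nonempty := ⟨a, by simp [ha, hay]⟩
  have h1 := Finset.max'_mem _ h
  rw [Finset.mem_filter] at h1
  exact ⟨_, h1.1, h1.2, fun b hb hby => Finset.le_max' _ _ (by simp [hb, hby])⟩

theorem gapS_cover (n : ℕ) (A : Finset ℕ) (hA : A ⊆ Finset.Icc 1 n) (hne : A.Nonempty)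
    (y : ℕ) (hy : y ∈ Finset.Icc 1 n) (hyA : y ∉ A) : ∃ a ∈ A, y ∈ gapS n A a := by
  simp only [gapS, Finset.mem_filter, Finset.mem_Icc] at hy ⊢
  by_cases h : ∃ a ∈ A, a < y
  · obtain ⟨a0, ha0, ha0y⟩ := h
    obtain ⟨a, ha, hay, hmax⟩ := exists_pred A y a0 ha0 ha0y
    refine ⟨a, ha, hy, Or.inl ⟨hay, ?_⟩⟩
    rcases circSucc_cases n A a ha with ⟨h1, h2, h3⟩ | ⟨h1, m, h2, h3, h4⟩
    · by_contra hc
      have : circSucc n A a ≠ y := fun h => hyA (h ▸ h1)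
      have := hmax _ h1 (by omega)
      omega
    · by_contra hc
      have := Finset.mem_Icc.1 (hA h2)
      omega
  · push Not at h
    refine ⟨A.max' hne, Finset.max'_mem _ _, hy, Or.inr ?_⟩
    rcases circSucc_cases n A _ (A.max'_mem hne) with ⟨h1, h2, h3⟩ | ⟨h1, m, h2, h3, h4⟩
    · have := Finset.le_max' _ _ h1
      omega
    · have := h m h2
      have : m ≠ y := fun h => hyA (h ▸ h2)
      omega

theorem weight_eq (n k : ℕ) (A : Finset ℕ) (hA : A ⊆ Finset.Icc 1 n) (hne : A.Nonempty) :
    weight n k A = (fib n k A).card := by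
  have h1 : weight n k A = (A.pi (fun a => Finset.powersetCard k (gapS n A a))).card := by
    rw [Finset.card_pi, weight]
    refine Finset.prod_congr rfl fun a ha => ?_
    rw [Finset.card_powersetCard, gapS_card n A hA a ha]
  rw [h1]
  have key : ∀ p ∈ A.pi (fun a => Finset.powersetCard k (gapS n A a)), ∀ a (ha : a ∈ A),
      (A ∪ A.attach.biUnion (fun a => p a.1 a.2)) ∩ gapS n A a = p a ha := by
    intro p hp a ha
    rw [Finset.mem_pi] at hp
    simp only [Finset.mem_powersetCard] at hp
    ext y
    simp only [Finset.mem_inter, Finset.mem_union, Finset.mem_biUnion, Finset.mem_attach, true_and,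
      Subtype.exists]
    constructor
    · rintro ⟨h | ⟨b, hb, hyb⟩, hy⟩
      · exact absurd h (gapS_notMem n A hA a y ha hy)
      · have := gapS_disj n A hA a b y ha hb hy ((hp b hb).1 hyb)
        subst this
        exact hyb
    · intro h
      exact ⟨Or.inr ⟨a, ha, h⟩, (hp a ha).1 h⟩
  refine Finset.card_bij' (fun p _ => A ∪ A.attach.biUnion (fun a => p a.1 a.2))
    (fun B _ => fun a _ => B ∩ gapS n A a) ?_ ?_ ?_ ?_
  · intro p hp
    have hp' := hp
    rw [Finset.mem_pi] at hp'
    simp only [Finset.mem_powersetCard] at hp'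
    simp only [fib, Finset.mem_filter, Finset.mem_powerset]
    refine ⟨Finset.union_subset hA ?_, Finset.subset_union_left, fun a ha => ?_⟩
    · intro y hy
      simp only [Finset.mem_biUnion, Finset.mem_attach, true_and, Subtype.exists] at hy
      obtain ⟨b, hb, hy⟩ := hy
      exact (Finset.mem_filter.1 ((hp' b hb).1 hy)).1
    · rw [key p hp a ha, (hp' a ha).2]
  · intro B hB
    simp only [fib, Finset.mem_filter, Finset.mem_powerset] at hB
    rw [Finset.mem_pi]
    intro a ha
    rw [Finset.mem_powersetCard]
    exact ⟨Finset.inter_subset_right, hB.2.2 a ha⟩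
  · intro p hp
    funext a ha
    exact key p hp a ha
  · intro B hB
    simp only [fib, Finset.mem_filter, Finset.mem_powerset] at hB
    ext y
    simp only [Finset.mem_inter, Finset.mem_union, Finset.mem_biUnion, Finset.mem_attach, true_and,
      Subtype.exists]
    constructor
    · rintro (h | ⟨b, hb, hy⟩)
      · exact hB.2.1 h
      · exact hy.1
    · intro hy
      by_cases hyA : y ∈ A
      · exact Or.inl hyA
      · obtain ⟨a, ha, hya⟩ := gapS_cover n A hA hne y (hB.1 hy) hyA
        exact Or.inr ⟨a, ha, hy, hya⟩

theorem fib_card (n k : ℕ) (A B : Finset ℕ) (hA : A ⊆ Finset.Icc 1 n) (hne : A.Nonempty)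
    (hB : B ∈ fib n k A) : B.card = (k + 1) * A.card := by
  simp only [fib, Finset.mem_filter, Finset.mem_powerset] at hB
  obtain ⟨hBn, hAB, hg⟩ := hB
  have h1 : B \ A = A.biUnion (fun a => B ∩ gapS n A a) := by
    ext y
    simp only [Finset.mem_sdiff, Finset.mem_biUnion, Finset.mem_inter]
    constructor
    · rintro ⟨hy, hyA⟩
      obtain ⟨a, ha, hya⟩ := gapS_cover n A hA hne y (hBn hy) hyA
      exact ⟨a, ha, hy, hya⟩
    · rintro ⟨a, ha, hy, hya⟩
      exact ⟨hy, gapS_notMem n A hA a y ha hya⟩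
  have h2 : (B \ A).card = A.card * k := by
    rw [h1, Finset.card_biUnion, Finset.sum_congr rfl hg]
    · simp
    · intro a ha b hb hab
      rw [Function.onFun, Finset.disjoint_left]
      intro y hy hy'
      exact hab (gapS_disj n A hA a b y ha hb (Finset.mem_inter.1 hy).2 (Finset.mem_inter.1 hy').2)
  have h3 := Finset.card_sdiff_add_card_eq_card hAB
  rw [← h3, h2]
  ring

theorem rk_split (B : Finset ℕ) (x y : ℕ) (hx : x ∈ B) (hxy : x < y) :
    rk B y = rk B x + 1 + (B.filter (fun b => x < b ∧ b < y)).card := by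
  unfold rk
  have h : B.filter (fun b => b < y) =
      insert x (B.filter (fun b => b < x)) ∪ B.filter (fun b => x < b ∧ b < y) := by
    ext z
    simp only [Finset.mem_filter, Finset.mem_union, Finset.mem_insert]
    constructor
    · rintro ⟨h1, h2⟩
      rcases lt_trichotomy z x with h | h | h
      · exact Or.inl (Or.inr ⟨h1, h⟩)
      · exact Or.inl (Or.inl h)
      · exact Or.inr ⟨h1, h, h2⟩
    · rintro ((rfl | ⟨h1, h2⟩) | ⟨h1, h2, h3⟩)
      · exact ⟨hx, hxy⟩
      · exact ⟨h1, by omega⟩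
      · exact ⟨h1, h3⟩
  rw [h, Finset.card_union_of_disjoint, Finset.card_insert_of_notMem]
  · simp
  · rw [Finset.disjoint_left]
    intro z hz hz'
    simp only [Finset.mem_filter, Finset.mem_insert] at hz hz'
    omega

theorem card_split (B : Finset ℕ) (x : ℕ) (hx : x ∈ B) :
    B.card = rk B x + 1 + (B.filter (fun b => x < b)).card := by
  have h := Finset.card_filter_add_card_filter_not (s := B) (fun b => b < x)
  have h2 : B.filter (fun b => ¬ b < x) = insert x (B.filter (fun b => x < b)) := by
    ext z
    simp only [Finset.mem_filter, Finset.mem_insert]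
    constructor
    · rintro ⟨h1, h2⟩
      by_cases h : z = x
      · exact Or.inl h
      · exact Or.inr ⟨h1, by omega⟩
    · rintro (rfl | ⟨h1, h2⟩)
      · exact ⟨hx, by omega⟩
      · exact ⟨h1, by omega⟩
  rw [h2, Finset.card_insert_of_notMem (by simp)] at h
  unfold rk
  omega

theorem rk_mono (B : Finset ℕ) {x y : ℕ} (h : x ≤ y) : rk B x ≤ rk B y := by
  apply Finset.card_le_card
  intro z hz
  simp only [Finset.mem_filter] at hz ⊢
  exact ⟨hz.1, by omega⟩

theorem rk_lt (B : Finset ℕ) {x y : ℕ} (hx : x ∈ B) (h : x < y) : rk B x < rk B y := by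
  rw [rk_split B x y hx h]; omega

theorem rk_lt_card (B : Finset ℕ) {x : ℕ} (hx : x ∈ B) : rk B x < B.card := by
  rw [card_split B x hx]; omega

theorem rk_surj (B : Finset ℕ) (j : ℕ) (hj : j < B.card) : ∃ y ∈ B, rk B y = j := by
  have := Finset.surj_on_of_inj_on_of_card_le (s := B) (t := Finset.range B.card)
    (fun y _ => rk B y) (fun y hy => Finset.mem_range.2 (rk_lt_card B hy))
    (fun x y hx hy hxy => by
      rcases lt_trichotomy x y with h | h | h
      · have := rk_lt B hx h; omega
      · exact h
      · have := rk_lt B hy h; omega) (by simp) j (Finset.mem_range.2 hj)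
  obtain ⟨y, hy, h⟩ := this
  exact ⟨y, hy, h.symm⟩

/-- the elements of `A` have constant rank modulo `k + 1`, and other elements of `B` do not -/
theorem fib_rk (n k : ℕ) (A B : Finset ℕ) (hA : A ⊆ Finset.Icc 1 n) (hne : A.Nonempty)
    (hB : B ∈ fib n k A) :
    (∀ a ∈ A, rk B a % (k + 1) = rk B (A.min' hne)) ∧
    (∀ y ∈ B, rk B y % (k + 1) = rk B (A.min' hne) → y ∈ A) := by
  simp only [fib, Finset.mem_filter, Finset.mem_powerset] at hB
  obtain ⟨hBn, hAB, hg⟩ := hB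
  have hA' : ∀ b ∈ A, 1 ≤ b ∧ b ≤ n := fun b hb => by simpa using hA hb
  have hB' : ∀ b ∈ B, 1 ≤ b ∧ b ≤ n := fun b hb => by simpa using hBn hb
  have hmin : ∀ b ∈ A, A.min' hne ≤ b := fun b hb => Finset.min'_le _ _ hb
  have hminA := A.min'_mem hne
  set m := A.min' hne with hm
  have hc : rk B m ≤ k := by
    rw [← hg _ (A.max'_mem hne)]
    apply Finset.card_le_card
    intro y hy
    simp only [Finset.mem_filter, Finset.mem_inter, gapS, Finset.mem_Icc] at hy ⊢
    refine ⟨hy.1, hB' y hy.1, Or.inr ?_⟩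
    rcases circSucc_cases n A _ (A.max'_mem hne) with ⟨h1, h2, h3⟩ | ⟨h1, m', h2, h3, h4⟩
    · have := Finset.le_max' _ _ h1
      omega
    · have := hmin m' h2
      omega
  have first : ∀ a, a ∈ A → rk B a % (k + 1) = rk B m := by
    intro a
    induction a using Nat.strong_induction_on with
    | _ a ih =>
      intro ha
      by_cases ham : a = m
      · rw [ham]; exact Nat.mod_eq_of_lt (by omega)
      · have := hmin a ha
        obtain ⟨p, hp, hpa, hpmax⟩ := exists_pred A a m hminA (by omega)
        have ihp := ih p hpa hp
        rw [rk_split B p a (hAB hp) hpa]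
        have : B.filter (fun b => p < b ∧ b < a) = B ∩ gapS n A p := by
          ext y
          simp only [Finset.mem_filter, Finset.mem_inter, gapS, Finset.mem_Icc]
          rcases circSucc_cases n A p hp with ⟨h1, h2, h3⟩ | ⟨h1, m', h2, h3, h4⟩
          · have h5 := h3 a ha hpa
            have h6 := hpmax _ h1
            have h7 := hA' _ ha
            have : circSucc n A p = a := by omega
            rw [this]
            constructor
            · rintro ⟨h, h'⟩
              exact ⟨h, hB' y h, Or.inl h'⟩
            · rintro ⟨h, h', h''⟩
              exact ⟨h, by omega⟩
          · have := h1 a ha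
            omega
        rw [this, hg p hp, add_assoc, add_comm 1 k, Nat.add_mod_right, ihp]
  refine ⟨first, fun y hy hyc => ?_⟩
  by_contra hyA
  by_cases hym : y < m
  · have := rk_lt B hy hym
    rw [Nat.mod_eq_of_lt (by omega)] at hyc
    omega
  · have : m ≠ y := fun h => hyA (h ▸ hminA)
    obtain ⟨p, hp, hpy, hpmax⟩ := exists_pred A y m hminA (by omega)
    have hlt : (B.filter (fun b => p < b ∧ b < y)).card < k := by
      rw [← hg p hp]
      apply Finset.card_lt_card
      have hcs : y < circSucc n A p := by
        have := hB' y hy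
        rcases circSucc_cases n A p hp with ⟨h1, h2, h3⟩ | ⟨h1, m', h2, h3, h4⟩
        · have h6 := hpmax _ h1
          have : circSucc n A p ≠ y := fun h => hyA (h ▸ h1)
          omega
        · have := hA' m' h2
          omega
      rw [Finset.ssubset_iff_of_subset]
      · refine ⟨y, ?_, by simp⟩
        simp only [Finset.mem_inter, gapS, Finset.mem_filter, Finset.mem_Icc]
        exact ⟨hy, hB' y hy, Or.inl ⟨hpy, hcs⟩⟩
      · intro z hz
        simp only [Finset.mem_inter, gapS, Finset.mem_filter, Finset.mem_Icc] at hz ⊢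
        exact ⟨hz.1, hB' z hz.1, Or.inl ⟨hz.2.1, by omega⟩⟩
    have h1 := rk_split B p y (hAB hp) hpy
    have h2 := first p hp
    rw [← h2] at hyc
    have h3 : (k + 1) ∣ rk B y - rk B p := (Nat.modEq_iff_dvd' (by omega)).1 hyc.symm
    have := Nat.le_of_dvd (by omega) h3
    omega

theorem fib_unique (n k : ℕ) (A A' B : Finset ℕ) (hA : A ⊆ Finset.Icc 1 n)
    (hA' : A' ⊆ Finset.Icc 1 n) (hB : B ∈ fib n k A) (hB' : B ∈ fib n k A')
    (hi : (A ∩ A').Nonempty) : A = A' := by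
  obtain ⟨x, hx⟩ := hi
  rw [Finset.mem_inter] at hx
  obtain ⟨h1, h2⟩ := fib_rk n k A B hA ⟨x, hx.1⟩ hB
  obtain ⟨g1, g2⟩ := fib_rk n k A' B hA' ⟨x, hx.2⟩ hB'
  have e := (h1 x hx.1).symm.trans (g1 x hx.2)
  simp only [fib, Finset.mem_filter] at hB hB'
  ext y
  constructor
  · intro hy
    exact g2 y (hB.2.1 hy) ((h1 y hy).trans e)
  · intro hy
    exact h2 y (hB'.2.1 hy) ((g1 y hy).trans e.symm)

theorem ekr_Icc (n m : ℕ) (hn : 2 * m ≤ n) (F : Finset (Finset ℕ))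
    (h1 : ∀ B ∈ F, B ⊆ Finset.Icc 1 n ∧ B.card = m)
    (h2 : ∀ B ∈ F, ∀ C ∈ F, (B ∩ C).Nonempty) : F.card ≤ (n - 1).choose (m - 1) := by
  let g : Finset ℕ → Finset (Fin n) := fun B => Finset.univ.filter (fun i => (i : ℕ) + 1 ∈ B)
  have hmap : ∀ B, B ⊆ Finset.Icc 1 n → (g B).image (fun i : Fin n => (i : ℕ) + 1) = B := by
    intro B hB
    ext y
    simp only [g, Finset.mem_image, Finset.mem_filter, Finset.mem_univ, true_and]
    constructor
    · rintro ⟨i, hi, rfl⟩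
      exact hi
    · intro hy
      have := Finset.mem_Icc.1 (hB hy)
      refine ⟨⟨y - 1, by omega⟩, ?_, ?_⟩
      · simp only
        rwa [Nat.sub_add_cancel this.1]
      · simp only
        omega
  have hinj : Set.InjOn g F := by
    intro B hB C hC h
    rw [← hmap B (h1 B hB).1, ← hmap C (h1 C hC).1, h]
  rw [← Finset.card_image_of_injOn hinj]
  apply Finset.erdos_ko_rado
  · intro X hX Y hY hd
    simp only [Finset.coe_image, Set.mem_image, Finset.mem_coe] at hX hY
    obtain ⟨B, hB, rfl⟩ := hX
    obtain ⟨C, hC, rfl⟩ := hY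
    obtain ⟨y, hy⟩ := h2 B hB C hC
    rw [Finset.mem_inter] at hy
    have := Finset.mem_Icc.1 ((h1 B hB).1 hy.1)
    have e : y - 1 + 1 = y := by omega
    have hd' := Finset.disjoint_left.1 hd
    refine @hd' (⟨y - 1, by omega⟩ : Fin n) ?_ ?_
    · simp [g, e, hy.1]
    · simp [g, e, hy.2]
  · intro X hX
    simp only [Finset.coe_image, Set.mem_image, Finset.mem_coe] at hX
    obtain ⟨B, hB, rfl⟩ := hX
    rw [← (h1 B hB).2]
    conv_rhs => rw [← hmap B (h1 B hB).1]
    rw [Finset.card_image_of_injective]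
    intro i j hij
    simp only at hij
    exact Fin.ext (by omega)
  · omega

/-- every `(k+1) r`-set containing `1` comes from a separated set containing `1` -/
theorem exists_fib (n k r : ℕ) (hr : 1 ≤ r) (hn : 2 * ((k + 1) * r) ≤ n)
    (B : Finset ℕ) (hB : B ⊆ Finset.Icc 1 n) (hc : B.card = (k + 1) * r) (h1B : 1 ∈ B) :
    ∃ A ∈ sepSets n k r, 1 ∈ A ∧ B ∈ fib n k A := by
  have hB' : ∀ b ∈ B, 1 ≤ b ∧ b ≤ n := fun b hb => by simpa using hB hb
  have hr1 : rk B 1 = 0 := by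
    unfold rk
    rw [Finset.card_eq_zero, Finset.filter_eq_empty_iff]
    intro y hy
    have := hB' y hy
    omega
  obtain ⟨A, hAdef⟩ : ∃ A, A = B.filter (fun y => (k + 1) ∣ rk B y) := ⟨_, rfl⟩
  have hmem : ∀ y, y ∈ A ↔ y ∈ B ∧ (k + 1) ∣ rk B y := by
    intro y; rw [hAdef, Finset.mem_filter]
  have h1A : 1 ∈ A := (hmem 1).2 ⟨h1B, by rw [hr1]; exact dvd_zero _⟩
  have hAB : A ⊆ B := fun y hy => ((hmem y).1 hy).1
  have hkr : k + 1 ≤ (k + 1) * r := Nat.le_mul_of_pos_right _ hr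
  -- rank gaps
  have hstep : ∀ a ∈ A, rk B a + (k + 1) ≤ (k + 1) * r := by
    intro a ha
    obtain ⟨ha1, i, hi⟩ := (hmem a).1 ha
    have := rk_lt_card B ha1
    rw [hc, hi] at this
    have : i < r := lt_of_mul_lt_mul_left this (Nat.zero_le _)
    rw [hi]
    calc (k + 1) * i + (k + 1) = (k + 1) * (i + 1) := by ring
      _ ≤ _ := Nat.mul_le_mul_left _ this
  have hstep2 : ∀ a ∈ A, ∀ b ∈ A, a < b → rk B a + (k + 1) ≤ rk B b := by
    intro a ha b hb hab
    obtain ⟨ha1, i, hi⟩ := (hmem a).1 ha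
    obtain ⟨hb1, j, hj⟩ := (hmem b).1 hb
    have := rk_lt B ha1 hab
    rw [hi, hj] at this
    have : i < j := lt_of_mul_lt_mul_left this (Nat.zero_le _)
    rw [hi, hj]
    calc (k + 1) * i + (k + 1) = (k + 1) * (i + 1) := by ring
      _ ≤ _ := Nat.mul_le_mul_left _ this
  have hnext : ∀ a ∈ A, rk B a + (k + 1) < (k + 1) * r →
      ∃ b ∈ A, a < b ∧ rk B b = rk B a + (k + 1) := by
    intro a ha h
    obtain ⟨b, hb, hbr⟩ := rk_surj B (rk B a + (k + 1)) (by omega)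
    refine ⟨b, (hmem b).2 ⟨hb, ?_⟩, ?_, hbr⟩
    · rw [hbr]
      exact dvd_add ((hmem a).1 ha).2 (dvd_refl _)
    · by_contra hlt
      have := rk_mono B (show b ≤ a by omega)
      omega
  have hcardA : A.card = r := by
    rw [← Finset.card_range r]
    refine Finset.card_bij (fun a _ => rk B a / (k + 1)) ?_ ?_ ?_
    · intro a ha
      have := hstep a ha
      rw [Finset.mem_range, Nat.div_lt_iff_lt_mul (by omega), mul_comm]
      omega
    · intro a ha b hb hab
      have e : rk B a = rk B b := by
        rw [← Nat.div_mul_cancel ((hmem a).1 ha).2, ← Nat.div_mul_cancel ((hmem b).1 hb).2, hab]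
      rcases lt_trichotomy a b with h | h | h
      · have := hstep2 a ha b hb h; omega
      · exact h
      · have := hstep2 b hb a ha h; omega
    · intro j hj
      rw [Finset.mem_range] at hj
      obtain ⟨y, hy, hyr⟩ := rk_surj B ((k + 1) * j)
        (by rw [hc]; exact Nat.mul_lt_mul_of_pos_left hj (by omega))
      refine ⟨y, (hmem y).2 ⟨hy, by rw [hyr]; exact dvd_mul_right _ _⟩, ?_⟩
      rw [hyr]
      exact Nat.mul_div_cancel_left _ (by omega)
  have hafter : ∀ a ∈ A, a + k ≤ n := by
    intro a ha
    have h1 := card_split B a (hAB ha)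
    have h2 := hstep a ha
    have h3 : (B.filter (fun b => a < b)).card ≤ (Finset.Ioc a n).card := by
      apply Finset.card_le_card
      intro y hy
      rw [Finset.mem_filter] at hy
      have := hB' y hy.1
      rw [Finset.mem_Ioc]
      omega
    rw [Nat.card_Ioc] at h3
    have := hB' a (hAB ha)
    omega
  refine ⟨A, ?_, h1A, ?_⟩
  · simp only [sepSets, Finset.mem_filter, Finset.mem_powerset]
    refine ⟨hAB.trans hB, hcardA, by omega, fun a ha b hb hab => ?_⟩
    have h1 := hstep2 a ha b hb hab
    have h2 := rk_split B a b (hAB ha) hab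
    have h3 : (B.filter (fun y => a < y ∧ y < b)).card ≤ (Finset.Ioo a b).card := by
      apply Finset.card_le_card
      intro y hy
      rw [Finset.mem_filter] at hy
      rw [Finset.mem_Ioo]
      exact hy.2
    rw [Nat.card_Ioo] at h3
    have := hafter b hb
    have := hB' a (hAB ha)
    omega
  · simp only [fib, Finset.mem_filter, Finset.mem_powerset]
    refine ⟨hB, hAB, fun a ha => ?_⟩
    rcases circSucc_cases n A a ha with ⟨h1, h2, h3⟩ | ⟨h1, m, h2, h3, h4⟩
    · have hs := hstep2 a ha _ h1 h2
      have hs2 := hstep _ h1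
      obtain ⟨b, hb, hab, hbr⟩ := hnext a ha (by omega)
      have h5 := h3 b hb hab
      have h6 := rk_mono B h5
      have h7 := rk_split B a _ (hAB ha) h2
      have h8 : B ∩ gapS n A a = B.filter (fun y => a < y ∧ y < circSucc n A a) := by
        ext y
        simp only [Finset.mem_filter, Finset.mem_inter, gapS, Finset.mem_Icc]
        have := hB' _ (hAB h1)
        constructor
        · rintro ⟨h, h', h''⟩
          exact ⟨h, by omega⟩
        · rintro ⟨h, h'⟩
          exact ⟨h, hB' y h, Or.inl h'⟩
      rw [h8]
      omega
    · have hm1 : m = 1 := by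
        have := h3 1 h1A
        have := hB' m (hAB h2)
        omega
      have hs := hstep a ha
      have h5 : rk B a + (k + 1) = (k + 1) * r := by
        by_contra hne
        obtain ⟨b, hb, hab, hbr⟩ := hnext a ha (by omega)
        have := h1 b hb
        omega
      have h7 := card_split B a (hAB ha)
      have h8 : B ∩ gapS n A a = B.filter (fun y => a < y) := by
        ext y
        simp only [Finset.mem_filter, Finset.mem_inter, gapS, Finset.mem_Icc]
        constructor
        · rintro ⟨h, h', h''⟩
          exact ⟨h, by omega⟩
        · rintro ⟨h, h'⟩
          have := hB' y h
          exact ⟨h, this, Or.inl ⟨h', by omega⟩⟩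
      rw [h8]
      omega

theorem sum_weight (n k r : ℕ) (hr : 1 ≤ r)
    (𝒜 : Finset (Finset ℕ)) (h𝒜 : 𝒜 ⊆ sepSets n k r) (hint : Intersecting 𝒜) :
    ∑ A ∈ 𝒜, weight n k A = (𝒜.biUnion (fib n k)).card := by
  have hs : ∀ A ∈ 𝒜, A ⊆ Finset.Icc 1 n := by
    intro A hA
    have := h𝒜 hA
    simp only [sepSets, Finset.mem_filter, Finset.mem_powerset] at this
    exact this.1
  rw [Finset.card_biUnion]
  · refine Finset.sum_congr rfl fun A hA => weight_eq n k A (hs A hA) ?_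
    obtain ⟨x, hx⟩ := hint A hA A hA
    exact ⟨x, (Finset.mem_inter.1 hx).1⟩
  · intro A hA A' hA' hne
    rw [Function.onFun, Finset.disjoint_left]
    intro B hB hB'
    exact hne (fib_unique n k A A' B (hs A hA) (hs A' hA') hB hB' (hint A hA A' hA'))

theorem mem_union_fib (n k r : ℕ)
    (𝒜 : Finset (Finset ℕ)) (h𝒜 : 𝒜 ⊆ sepSets n k r) (hint : Intersecting 𝒜)
    (B : Finset ℕ) (hB : B ∈ 𝒜.biUnion (fib n k)) :
    B ⊆ Finset.Icc 1 n ∧ B.card = (k + 1) * r := by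
  obtain ⟨A, hA, hBA⟩ := Finset.mem_biUnion.1 hB
  have h := h𝒜 hA
  simp only [sepSets, Finset.mem_filter, Finset.mem_powerset] at h
  obtain ⟨x, hx⟩ := hint A hA A hA
  refine ⟨?_, ?_⟩
  · simp only [fib, Finset.mem_filter, Finset.mem_powerset] at hBA
    exact hBA.1
  · rw [fib_card n k A B h.1 ⟨x, (Finset.mem_inter.1 hx).1⟩ hBA, h.2.1]

theorem stmt5 (n k r : ℕ) (hk : 1 ≤ k) (hr : 1 ≤ r) (hn : 2 * ((k + 1) * r) ≤ n)
    (𝒜 : Finset (Finset ℕ)) (h𝒜 : 𝒜 ⊆ sepSets n k r) (hint : Intersecting 𝒜) :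
    ∑ A ∈ 𝒜, weight n k A ≤ (n - 1).choose ((k + 1) * r - 1) ∧
      ∑ A ∈ (sepSets n k r).filter (fun A => 1 ∈ A), weight n k A
        = (n - 1).choose ((k + 1) * r - 1) := by
  have hkr : k + 1 ≤ (k + 1) * r := Nat.le_mul_of_pos_right _ hr
  constructor
  · rw [sum_weight n k r hr 𝒜 h𝒜 hint]
    refine ekr_Icc n _ hn _ (fun B hB => mem_union_fib n k r 𝒜 h𝒜 hint B hB) ?_
    intro B hB C hC
    obtain ⟨A, hA, hBA⟩ := Finset.mem_biUnion.1 hB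
    obtain ⟨A', hA', hCA⟩ := Finset.mem_biUnion.1 hC
    simp only [fib, Finset.mem_filter] at hBA hCA
    exact (hint A hA A' hA').mono (Finset.inter_subset_inter hBA.2.1 hCA.2.1)
  · have hint' : Intersecting ((sepSets n k r).filter (fun A => 1 ∈ A)) := by
      intro A hA A' hA'
      exact ⟨1, Finset.mem_inter.2 ⟨(Finset.mem_filter.1 hA).2, (Finset.mem_filter.1 hA').2⟩⟩
    have hsub := Finset.filter_subset (fun A => 1 ∈ A) (sepSets n k r)
    rw [sum_weight n k r hr _ hsub hint']
    have : (n - 1).choose ((k + 1) * r - 1) =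
        (Finset.powersetCard ((k + 1) * r - 1) (Finset.Icc 2 n)).card := by
      rw [Finset.card_powersetCard, Nat.card_Icc]
      congr 1
    rw [this]
    refine Finset.card_bij' (fun B _ => B.erase 1) (fun C _ => insert 1 C) ?_ ?_ ?_ ?_
    all_goals
      have one_mem : ∀ B ∈ ((sepSets n k r).filter (fun A => 1 ∈ A)).biUnion (fib n k), 1 ∈ B := by
        intro B hB
        obtain ⟨A, hA, hBA⟩ := Finset.mem_biUnion.1 hB
        simp only [fib, Finset.mem_filter] at hBA
        exact hBA.2.1 (Finset.mem_filter.1 hA).2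
    · intro B hB
      obtain ⟨h1, h2⟩ := mem_union_fib n k r _ hsub hint' B hB
      rw [Finset.mem_powersetCard, Finset.card_erase_of_mem (one_mem B hB), h2]
      refine ⟨fun y hy => ?_, rfl⟩
      rw [Finset.mem_erase] at hy
      have := Finset.mem_Icc.1 (h1 hy.2)
      rw [Finset.mem_Icc]
      omega
    · intro C hC
      rw [Finset.mem_powersetCard] at hC
      have h1C : 1 ∉ C := fun h => by
        have := Finset.mem_Icc.1 (hC.1 h)
        omega
      obtain ⟨A, hA, h1A, hBA⟩ := exists_fib n k r hr hn (insert 1 C) (by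
          intro y hy
          rw [Finset.mem_insert] at hy
          rw [Finset.mem_Icc]
          rcases hy with rfl | hy
          · omega
          · have := Finset.mem_Icc.1 (hC.1 hy)
            omega) (by rw [Finset.card_insert_of_notMem h1C, hC.2]; omega) (by simp)
      exact Finset.mem_biUnion.2 ⟨A, Finset.mem_filter.2 ⟨hA, h1A⟩, hBA⟩
    · intro B hB
      exact Finset.insert_erase (one_mem B hB)
    · intro C hC
      rw [Finset.mem_powersetCard] at hC
      exact Finset.erase_insert fun h => by
        have := Finset.mem_Icc.1 (hC.1 h)
        omega
end

section
/- Let n, k, r be positive integers with n ≥ (k+1)r. Then the number of k-separated r-subsets of [n] that contain the element 1 is binomial(n−kr−1, r−1); that is, |{A ∈ [n]^(r)_k : 1 ∈ A}| = binomial(n−kr−1, r−1). -/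
/-- Linear `k`-separated `s`-subsets of `[c, c+m)`. -/
def linSets (k c m s : ℕ) : Finset (Finset ℕ) :=
  (Finset.powersetCard s (Finset.Ico c (c + m))).filter fun A =>
    ∀ a ∈ A, ∀ b ∈ A, a < b → k < b - a

theorem mem_linSets {k c m s : ℕ} {A : Finset ℕ} : A ∈ linSets k c m s ↔
    (∀ x ∈ A, c ≤ x ∧ x < c + m) ∧ A.card = s ∧ ∀ a ∈ A, ∀ b ∈ A, a < b → k < b - a := by
  simp only [linSets, Finset.mem_filter, Finset.mem_powersetCard, Finset.subset_iff,
    Finset.mem_Ico, and_assoc]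

theorem linSets_succ (k c m s : ℕ) : linSets k c (m + 1) (s + 1) =
    linSets k c m (s + 1) ∪ (linSets k c (m - k) s).image (insert (c + m)) := by
  ext A
  simp only [Finset.mem_union, Finset.mem_image, mem_linSets]
  constructor
  · rintro ⟨h1, h2, h3⟩
    by_cases h : c + m ∈ A
    · right
      refine ⟨A.erase (c + m), ⟨?_, ?_, ?_⟩, Finset.insert_erase h⟩
      · intro x hx
        rw [Finset.mem_erase] at hx
        have := h1 x hx.2
        have := h3 x hx.2 _ h (by omega)
        omega
      · rw [Finset.card_erase_of_mem h]; omega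
      · intro a ha b hb
        exact h3 a (Finset.mem_of_mem_erase ha) b (Finset.mem_of_mem_erase hb)
    · left
      refine ⟨fun x hx => ?_, h2, h3⟩
      have := h1 x hx
      have : x ≠ c + m := fun e => h (e ▸ hx)
      omega
  · rintro (⟨h1, h2, h3⟩ | ⟨B, ⟨h1, h2, h3⟩, rfl⟩)
    · refine ⟨fun x hx => ?_, h2, h3⟩
      have := h1 x hx
      omega
    · refine ⟨?_, ?_, ?_⟩
      · intro x hx
        rcases Finset.mem_insert.1 hx with rfl | hx
        · omega
        · have := h1 x hx
          omega
      · rw [Finset.card_insert_of_notMem, h2]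
        intro h
        have := h1 _ h
        omega
      · intro a ha b hb hab
        rcases Finset.mem_insert.1 ha with rfl | ha <;> rcases Finset.mem_insert.1 hb with rfl | hb
        · omega
        · have := h1 _ hb
          omega
        · have := h1 _ ha
          omega
        · exact h3 a ha b hb hab

theorem card_linSets_succ (k c m s : ℕ) : (linSets k c (m + 1) (s + 1)).card =
    (linSets k c m (s + 1)).card + (linSets k c (m - k) s).card := by
  rw [linSets_succ, Finset.card_union_of_disjoint, Finset.card_image_of_injOn]
  · intro A hA B hB hAB
    have hA' : c + m ∉ A := fun h => by
      have := (mem_linSets.1 hA).1 _ h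
      omega
    have hB' : c + m ∉ B := fun h => by
      have := (mem_linSets.1 hB).1 _ h
      omega
    rw [← Finset.erase_insert hA', ← Finset.erase_insert hB']
    exact congrArg (fun S => Finset.erase S (c + m)) hAB
  · rw [Finset.disjoint_left]
    intro A hA hA2
    obtain ⟨B, _, rfl⟩ := Finset.mem_image.1 hA2
    have := (mem_linSets.1 hA).1 _ (Finset.mem_insert_self _ _)
    omega

theorem card_linSets (k c m s : ℕ) :
    (linSets k c m s).card = (m + k - k * s).choose s := by
  induction m using Nat.strong_induction_on generalizing s with
  | _ m ih =>
    rcases s with _ | s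
    · rw [Nat.choose_zero_right, Finset.card_eq_one]
      refine ⟨∅, ?_⟩
      ext A
      rw [mem_linSets, Finset.mem_singleton, Finset.card_eq_zero]
      constructor
      · exact fun h => h.2.1
      · rintro rfl
        simp
    · rcases m with _ | m
      · have h0 : 0 + k - k * (s + 1) = 0 := by rw [mul_add]; omega
        rw [h0, Nat.choose_zero_succ, Finset.card_eq_zero, Finset.eq_empty_iff_forall_notMem]
        intro A hA
        obtain ⟨h1, h2, -⟩ := mem_linSets.1 hA
        obtain ⟨x, hx⟩ := Finset.card_pos.1 (by omega : 0 < A.card)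
        have := h1 x hx
        omega
      · rw [card_linSets_succ, ih m (by omega), ih (m - k) (by omega)]
        rcases s with _ | s
        · simp
        have e : k * (s + 1) = k * s + k := by ring
        have e1 : k * (s + 1 + 1) = k * s + k + k := by ring
        rw [e1, e]
        by_cases h : k * s + k ≤ m
        · have a1 : m + 1 + k - (k * s + k + k) = (m - (k * s + k)) + 1 := by omega
          have a2 : m + k - (k * s + k + k) = m - (k * s + k) := by omega
          have a3 : m - k + k - (k * s + k) = m - (k * s + k) := by omega
          rw [a1, a2, a3, Nat.choose_succ_succ, add_comm]
        · have a1 : m + 1 + k - (k * s + k + k) = 0 := by omega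
          have a2 : m + k - (k * s + k + k) = 0 := by omega
          have a3 : m - k + k - (k * s + k) = 0 := by omega
          rw [a1, a2, a3]
          simp

theorem stmt7 (n k r : ℕ) (hk : 1 ≤ k) (hr : 1 ≤ r) (hn : (k + 1) * r ≤ n) :
    ((sepSets n k r).filter fun A => 1 ∈ A).card = (n - k * r - 1).choose (r - 1) := by
  obtain ⟨s, rfl⟩ : ∃ s, r = s + 1 := ⟨r - 1, by omega⟩
  have hn' : k * s + k + s + 1 ≤ n := by
    have : (k + 1) * (s + 1) = k * s + k + s + 1 := by ring
    omega
  have key : ((sepSets n k (s + 1)).filter fun A => 1 ∈ A) =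
      (linSets k (k + 2) (n - (2 * k + 1)) s).image (insert 1) := by
    ext A
    simp only [sepSets, Finset.mem_filter, Finset.mem_powerset, Finset.subset_iff,
      Finset.mem_Icc, Finset.mem_image, mem_linSets]
    constructor
    · rintro ⟨⟨h1, h2, h4, h3⟩, h⟩
      refine ⟨A.erase 1, ⟨?_, ?_, ?_⟩, Finset.insert_erase h⟩
      · intro x hx
        rw [Finset.mem_erase] at hx
        have := h1 hx.2
        have := h3 1 h x hx.2 (by omega)
        omega
      · rw [Finset.card_erase_of_mem h]; omega
      · intro a ha b hb hab
        exact (h3 a (Finset.mem_of_mem_erase ha) b (Finset.mem_of_mem_erase hb) hab).1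
    · rintro ⟨B, ⟨h1, h2, h3⟩, rfl⟩
      refine ⟨⟨?_, ?_, by omega, ?_⟩, Finset.mem_insert_self _ _⟩
      · intro x hx
        rcases Finset.mem_insert.1 hx with rfl | hx
        · omega
        · have := h1 x hx
          omega
      · rw [Finset.card_insert_of_notMem, h2]
        intro h
        have := h1 _ h
        omega
      · intro a ha b hb hab
        rcases Finset.mem_insert.1 ha with rfl | ha <;> rcases Finset.mem_insert.1 hb with rfl | hb
        · omega
        · have := h1 _ hb
          omega
        · have := h1 _ ha
          omega
        · have := h1 _ ha
          have := h1 _ hb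
          have := h3 a ha b hb hab
          omega
  rw [key, Finset.card_image_of_injOn, card_linSets, Nat.add_sub_cancel]
  · rcases s with _ | s
    · simp
    · congr 1
      have e : k * (s + 1) = k * s + k := by ring
      have e1 : k * (s + 1 + 1) = k * s + k + k := by ring
      rw [e1]
      rw [e] at hn' ⊢
      omega
  · intro A hA B hB hAB
    have hA' : 1 ∉ A := fun h => by
      have := (mem_linSets.1 hA).1 _ h
      omega
    have hB' : 1 ∉ B := fun h => by
      have := (mem_linSets.1 hB).1 _ h
      omega
    rw [← Finset.erase_insert hA', ← Finset.erase_insert hB']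
    exact congrArg (fun S => Finset.erase S 1) hAB
end

section
/- Let n ≥ 2 and r ≥ 1 be integers, and let A, B ∈ [n]^(r)_* be separated r-subsets of [n] with A ≠ B. If f(A) = f(B), where f is the compression map, then the symmetric difference A Δ B equals {1, 2}. -/
/-- The compression map `f : [n] → [n-1]`: `f 1 = 1`, `f j = j - 1` for `j ≥ 2`. -/
def fmap (j : ℕ) : ℕ := if j ≤ 1 then j else j - 1

/-- Image of a family of sets under the compression map. -/
def famImage (𝒢 : Finset (Finset ℕ)) : Finset (Finset ℕ) :=
  𝒢.image fun G => G.image fmap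

/-- Image of a family of sets under the `j`-fold iterate of the compression map. -/
def famImageIter (j : ℕ) (𝒢 : Finset (Finset ℕ)) : Finset (Finset ℕ) :=
  𝒢.image fun G => G.image (fmap^[j])

/-- `𝒢 - {1} = {G \ {1} : G ∈ 𝒢}`. -/
def famErase1 (𝒢 : Finset (Finset ℕ)) : Finset (Finset ℕ) :=
  𝒢.image fun G => G.erase 1

theorem stmt8 (n r : ℕ) (hn : 2 ≤ n) (hr : 1 ≤ r)
    (A B : Finset ℕ) (hA : A ∈ sepSets n 1 r) (hB : B ∈ sepSets n 1 r)
    (hne : A ≠ B) (h : A.image fmap = B.image fmap) :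
    symmDiff A B = {1, 2} := by
  simp only [sepSets, Finset.mem_filter, Finset.mem_powerset] at hA hB
  obtain ⟨sA, -, -, gA⟩ := hA
  obtain ⟨sB, -, -, gB⟩ := hB
  have zA : 0 ∉ A := fun h0 => by simpa using sA h0
  have zB : 0 ∉ B := fun h0 => by simpa using sB h0
  have nA : ¬ (1 ∈ A ∧ 2 ∈ A) := fun ⟨h1, h2⟩ => by
    have := gA 1 h1 2 h2; omega
  have nB : ¬ (1 ∈ B ∧ 2 ∈ B) := fun ⟨h1, h2⟩ => by
    have := gB 1 h1 2 h2; omega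
  -- membership in the image
  have key : ∀ C : Finset ℕ, 0 ∉ C → ∀ y, 1 ≤ y →
      (y ∈ C.image fmap ↔ (y + 1 ∈ C ∨ (y = 1 ∧ 1 ∈ C))) := by
    intro C hC y hy
    rw [Finset.mem_image]
    constructor
    · rintro ⟨a, ha, hf⟩
      unfold fmap at hf
      split_ifs at hf with h1
      · right
        have : a = 1 := by omega
        subst this
        exact ⟨hf.symm, ha⟩
      · left
        have : a = y + 1 := by omega
        exact this ▸ ha
    · rintro (h1 | ⟨rfl, h1⟩)
      · refine ⟨y + 1, h1, ?_⟩
        unfold fmap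
        split_ifs <;> omega
      · exact ⟨1, h1, by simp [fmap]⟩
  have big : ∀ x, x ≠ 1 → x ≠ 2 → (x ∈ A ↔ x ∈ B) := by
    intro x h1 h2
    rcases Nat.eq_zero_or_pos x with rfl | h0
    · simp [zA, zB]
    · have kA := key A zA (x - 1) (by omega)
      have kB := key B zB (x - 1) (by omega)
      have e : x - 1 + 1 = x := by omega
      have e' : ¬ (x - 1 = 1) := by omega
      rw [e] at kA kB
      rw [h] at kA
      tauto
  have small : (2 ∈ A ∨ 1 ∈ A) ↔ (2 ∈ B ∨ 1 ∈ B) := by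
    have kA := key A zA 1 le_rfl
    have kB := key B zB 1 le_rfl
    rw [h] at kA
    norm_num at kA kB
    exact kA.symm.trans kB
  have diff : ¬ ((1 ∈ A ↔ 1 ∈ B) ∧ (2 ∈ A ↔ 2 ∈ B)) := by
    rintro ⟨h1, h2⟩
    apply hne
    ext x
    by_cases e1 : x = 1
    · subst e1; exact h1
    by_cases e2 : x = 2
    · subst e2; exact h2
    exact big x e1 e2
  clear key h hne gA gB sA sB
  ext x
  rw [Finset.mem_symmDiff, Finset.mem_insert, Finset.mem_singleton]
  by_cases e1 : x = 1
  · subst e1; simp only [true_or, iff_true]; clear big; grind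
  by_cases e2 : x = 2
  · subst e2; simp only [or_true, iff_true]; clear big; grind
  have := big x e1 e2
  tauto
end

section
/- Let n, k, r be positive integers and let A, B ∈ [n]^(r)_k be k-separated r-subsets of [n] with A ≠ B. Let 1 ≤ j ≤ k and let f^j denote the compression map f iterated j times. If f^j(A) = f^j(B), then there exist integers c, d with 1 ≤ c < d ≤ j+1 such that the symmetric difference A Δ B equals {c, d}. -/
theorem fmap_iter_aux (j x : ℕ) (hx : 1 ≤ x) : fmap^[j] x = max 1 (x - j) := by
  induction j with
  | zero => simp [hx]
  | succ j ih =>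
    rw [Function.iterate_succ_apply', ih]
    unfold fmap
    split_ifs <;> omega

theorem stmt9_aux (k j : ℕ) (A B : Finset ℕ) (hjk : j ≤ k)
    (pA : ∀ a ∈ A, 1 ≤ a) (pB : ∀ a ∈ B, 1 ≤ a)
    (sA : ∀ a ∈ A, ∀ b ∈ A, a < b → k < b - a)
    (sB : ∀ a ∈ B, ∀ b ∈ B, a < b → k < b - a)
    (h : A.image (fmap^[j]) = B.image (fmap^[j]))
    (x : ℕ) (hxA : x ∈ A) (hxB : x ∉ B) :
    ∃ c d : ℕ, 1 ≤ c ∧ c < d ∧ d ≤ j + 1 ∧ symmDiff A B = {c, d} := by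
  have key : ∀ C D : Finset ℕ, (∀ a ∈ C, 1 ≤ a) → (∀ a ∈ D, 1 ≤ a) →
      C.image (fmap^[j]) = D.image (fmap^[j]) → ∀ z ∈ C, ∃ y ∈ D,
      max 1 (y - j) = max 1 (z - j) := by
    intro C D pC pD hCD z hz
    have h1 : fmap^[j] z ∈ D.image (fmap^[j]) := hCD ▸ Finset.mem_image_of_mem _ hz
    obtain ⟨y, hy, hyz⟩ := Finset.mem_image.1 h1
    rw [fmap_iter_aux j y (pD y hy), fmap_iter_aux j z (pC z hz)] at hyz
    exact ⟨y, hy, hyz⟩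
  obtain ⟨y, hy, hyx⟩ := key A B pA pB h x hxA
  have hne : x ≠ y := fun e => hxB (e ▸ hy)
  have hx1 := pA x hxA
  have hy1 := pB y hy
  have hxj : x ≤ j + 1 := by omega
  have hyj : y ≤ j + 1 := by omega
  have uA : ∀ a ∈ A, a ≤ j + 1 → a = x := by
    intro a ha haj
    have := pA a ha
    rcases lt_trichotomy a x with hl | hl | hl
    · have := sA a ha x hxA hl
      omega
    · exact hl
    · have := sA x hxA a ha hl
      omega
  have uB : ∀ a ∈ B, a ≤ j + 1 → a = y := by
    intro a ha haj
    have := pB a ha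
    rcases lt_trichotomy a y with hl | hl | hl
    · have := sB a ha y hy hl
      omega
    · exact hl
    · have := sB y hy a ha hl
      omega
  have hs : symmDiff A B = {x, y} := by
    ext z
    simp only [Finset.mem_symmDiff, Finset.mem_insert, Finset.mem_singleton]
    constructor
    · rintro (⟨h1, h2⟩ | ⟨h1, h2⟩)
      · obtain ⟨w, hw, hwz⟩ := key A B pA pB h z h1
        have : w ≠ z := fun e => h2 (e ▸ hw)
        exact Or.inl (uA z h1 (by have := pB w hw; omega))
      · obtain ⟨w, hw, hwz⟩ := key B A pB pA h.symm z h1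
        have : w ≠ z := fun e => h2 (e ▸ hw)
        exact Or.inr (uB z h1 (by have := pA w hw; omega))
    · rintro (rfl | rfl)
      · exact Or.inl ⟨hxA, hxB⟩
      · exact Or.inr ⟨hy, fun hyA => hne (uA _ hyA hyj).symm⟩
  rcases lt_or_gt_of_ne hne with hl | hl
  · exact ⟨x, y, hx1, hl, hyj, hs⟩
  · exact ⟨y, x, hy1, hl, hxj, by rw [hs, Finset.pair_comm]⟩

theorem stmt9 (n k r j : ℕ) (hn : 1 ≤ n) (hk : 1 ≤ k) (hr : 1 ≤ r)
    (A B : Finset ℕ) (hA : A ∈ sepSets n k r) (hB : B ∈ sepSets n k r)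
    (hne : A ≠ B) (hj1 : 1 ≤ j) (hjk : j ≤ k)
    (h : A.image (fmap^[j]) = B.image (fmap^[j])) :
    ∃ c d : ℕ, 1 ≤ c ∧ c < d ∧ d ≤ j + 1 ∧ symmDiff A B = {c, d} := by
  simp only [sepSets, Finset.mem_filter, Finset.mem_powerset] at hA hB
  obtain ⟨iA, -, -, sA⟩ := hA
  obtain ⟨iB, -, -, sB⟩ := hB
  have pA : ∀ a ∈ A, 1 ≤ a := fun a ha => (Finset.mem_Icc.1 (iA ha)).1
  have pB : ∀ a ∈ B, 1 ≤ a := fun a ha => (Finset.mem_Icc.1 (iB ha)).1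
  have tA : ∀ a ∈ A, ∀ b ∈ A, a < b → k < b - a := fun a ha b hb hl => (sA a ha b hb hl).1
  have tB : ∀ a ∈ B, ∀ b ∈ B, a < b → k < b - a := fun a ha b hb hl => (sB a ha b hb hl).1
  by_cases hAB : A ⊆ B
  · have hBA : ¬ B ⊆ A := fun hBA => hne (Finset.Subset.antisymm hAB hBA)
    obtain ⟨x, hxB, hxA⟩ := Finset.not_subset.1 hBA
    rw [symmDiff_comm]
    exact stmt9_aux k j B A hjk pB pA tB tA h.symm x hxB hxA
  · obtain ⟨x, hxA, hxB⟩ := Finset.not_subset.1 hAB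
    exact stmt9_aux k j A B hjk pA pB tA tB h x hxA hxB
end

section
/- Let n and r be positive integers with n ≥ 2r+1, and let A ∈ [n]^(r)_* be a separated r-subset of [n] such that it is not the case that both 1 ∈ A and 3 ∈ A, and it is not the case that both 2 ∈ A and n ∈ A. Then f(A) is a separated r-subset of [n−1], i.e. f(A) ∈ [n−1]^(r)_*. -/
theorem stmt10 (n r : ℕ) (hr : 1 ≤ r) (hn : 2 * r + 1 ≤ n)
    (A : Finset ℕ) (hA : A ∈ sepSets n 1 r)
    (h13 : ¬(1 ∈ A ∧ 3 ∈ A)) (h2n : ¬(2 ∈ A ∧ n ∈ A)) :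
    A.image fmap ∈ sepSets (n - 1) 1 r := by
  simp only [sepSets, Finset.mem_filter, Finset.mem_powerset] at hA ⊢
  obtain ⟨hsub, hcard, hn1, hsep⟩ := hA
  have hb : ∀ a ∈ A, 1 ≤ a ∧ a ≤ n := fun a ha => Finset.mem_Icc.mp (hsub ha)
  have key : ∀ a ∈ A, ∀ b ∈ A, a < b →
      1 < fmap b - fmap a ∧ fmap b - fmap a + 1 < n - 1 := by
    intro a ha b hbA hab
    have h1 := hb a ha
    have h2 := hb b hbA
    have h3 := hsep a ha b hbA hab
    have h4 : ¬(a = 1 ∧ b = 3) := by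
      rintro ⟨rfl, rfl⟩
      exact h13 ⟨ha, hbA⟩
    have h5 : ¬(a = 2 ∧ b = n) := by
      rintro ⟨rfl, rfl⟩
      exact h2n ⟨ha, hbA⟩
    unfold fmap
    split_ifs <;> omega
  refine ⟨?_, ?_, by omega, ?_⟩
  · intro x hx
    obtain ⟨a, ha, rfl⟩ := Finset.mem_image.mp hx
    have h1 := hb a ha
    rw [Finset.mem_Icc]
    unfold fmap
    split_ifs <;> omega
  · rw [Finset.card_image_of_injOn, hcard]
    intro a ha b hbA hab
    rcases lt_trichotomy a b with h | h | h
    · have := key a ha b hbA h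
      omega
    · exact h
    · have := key b hbA a ha h
      omega
  · intro x hx y hy hxy
    obtain ⟨a, ha, rfl⟩ := Finset.mem_image.mp hx
    obtain ⟨b, hbA, rfl⟩ := Finset.mem_image.mp hy
    apply key a ha b hbA
    by_contra hle
    unfold fmap at hxy
    split_ifs at hxy <;> omega
end

section
/- With 𝒜, f, ℬ, 𝒞, 𝒟, ℰ, ℱ, ℋ as in the context: every member of ℋ is a separated (r−1)-subset of [n−1], i.e. ℋ ⊆ [n−1]^(r−1)_*. -/
theorem key12 (n r : ℕ) (hr : 2 ≤ r) (hn : 2 * r + 1 ≤ n) (A : Finset ℕ)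
    (hA : A ∈ sepSets n 1 r) (h : 1 ∈ A ∨ 2 ∈ A) :
    (A.image fmap).erase 1 ∈ sepSets (n - 1) 1 (r - 1) := by
  simp only [sepSets, Finset.mem_filter, Finset.mem_powerset] at hA ⊢
  obtain ⟨hsub, hcard, -, hsep⟩ := hA
  have hb : ∀ a ∈ A, 1 ≤ a ∧ a ≤ n := fun a ha => Finset.mem_Icc.mp (hsub ha)
  have hinj : Set.InjOn fmap (A : Set ℕ) := by
    intro a ha b hb' hab
    have ha : a ∈ A := ha
    have hb' : b ∈ A := hb'
    have h1 := hb a ha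
    have h2 := hb b hb'
    have h3 := hsep a ha b hb'
    have h4 := hsep b hb' a ha
    unfold fmap at hab
    split_ifs at hab <;> omega
  have hmem : ∀ x ∈ (A.image fmap).erase 1, x + 1 ∈ A ∧ 2 ≤ x := by
    intro x hx
    obtain ⟨hx1, hx2⟩ := Finset.mem_erase.mp hx
    obtain ⟨a, ha, rfl⟩ := Finset.mem_image.mp hx2
    have h1 := hb a ha
    unfold fmap at hx1 ⊢
    split_ifs at hx1 ⊢ with hc
    · omega
    · have : a - 1 + 1 = a := by omega
      rw [this]
      exact ⟨ha, by omega⟩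
  have h1mem : 1 ∈ A.image fmap := by
    rcases h with h | h
    · exact Finset.mem_image.mpr ⟨1, h, by simp [fmap]⟩
    · exact Finset.mem_image.mpr ⟨2, h, by simp [fmap]⟩
  refine ⟨?_, ?_, by omega, ?_⟩
  · intro x hx
    have h1 := hmem x hx
    have h2 := hb _ h1.1
    rw [Finset.mem_Icc]
    omega
  · rw [Finset.card_erase_of_mem h1mem, Finset.card_image_of_injOn hinj, hcard]
  · intro a ha b hb' hab
    have h1 := hmem a ha
    have h2 := hmem b hb'
    have h3 := hsep _ h1.1 _ h2.1 (by omega)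
    have h4 := hb _ h2.1
    omega

theorem stmt12 (n r : ℕ) (hr : 2 ≤ r) (hn : 2 * r + 1 ≤ n)
(𝒜 ℬ 𝒞 𝒟 ℰ ℱ ℋ : Finset (Finset ℕ))
    (h𝒜 : 𝒜 ⊆ sepSets n 1 r) (hint : Intersecting 𝒜)
    (hℬ : ℬ = 𝒜.filter fun A => 1 ∉ A ∧ (2 ∉ A ∨ n ∉ A))
    (h𝒞 : 𝒞 = 𝒜.filter fun A => 1 ∈ A ∧ 3 ∉ A)
    (h𝒟 : 𝒟 = 𝒜.filter fun A => 1 ∈ A ∧ 3 ∈ A)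
    (hℰ : ℰ = 𝒜.filter fun A => 2 ∈ A ∧ n ∈ A)
    (hℱ : ℱ = famImage ℬ ∩ famImage 𝒞)
    (hℋ : ℋ = famErase1 (famImage 𝒟) ∪ famErase1 (famImage ℰ) ∪ famErase1 ℱ) :
    ℋ ⊆ sepSets (n - 1) 1 (r - 1) := by
  subst hℬ h𝒞 h𝒟 hℰ hℱ hℋ
  intro X hX
  simp only [famErase1, famImage, Finset.mem_union, Finset.mem_image, Finset.mem_inter,
    Finset.mem_filter] at hX
  rcases hX with (⟨Y, ⟨A, ⟨hA, h1, -⟩, rfl⟩, rfl⟩ | ⟨Y, ⟨A, ⟨hA, h2, -⟩, rfl⟩, rfl⟩) |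
    ⟨Y, ⟨-, ⟨A, ⟨hA, h1, -⟩, rfl⟩⟩, rfl⟩
  · exact key12 n r hr hn A (h𝒜 hA) (Or.inl h1)
  · exact key12 n r hr hn A (h𝒜 hA) (Or.inr h2)
  · exact key12 n r hr hn A (h𝒜 hA) (Or.inl h1)
end

section
/- With 𝒜, f, ℬ, 𝒞, 𝒟, ℰ, ℱ as in the context: the three families of sets f(𝒟) − {1}, f(ℰ) − {1} and ℱ − {1} are pairwise disjoint. -/
/-- Membership in the compressed set with `1` removed. -/
theorem mem_erase_image_fmap (G : Finset ℕ) (m : ℕ) (hm : 2 ≤ m) :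
    m ∈ (G.image fmap).erase 1 ↔ m + 1 ∈ G := by
  rw [Finset.mem_erase, Finset.mem_image]
  constructor
  · rintro ⟨_, a, ha, h⟩
    unfold fmap at h
    have : a = m + 1 := by split_ifs at h <;> omega
    exact this ▸ ha
  · intro h
    refine ⟨by omega, m + 1, h, ?_⟩
    unfold fmap
    split_ifs <;> omega

/-- A separated set containing `1` does not contain `n`. -/
theorem not_mem_of_one_mem (n r : ℕ) (hn : 2 ≤ n) (A : Finset ℕ)
    (hA : A ∈ sepSets n 1 r) (h1 : 1 ∈ A) : n ∉ A := by
  intro h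
  unfold sepSets at hA
  have := (Finset.mem_filter.1 hA).2.2.2 1 h1 n h (by omega)
  omega

theorem stmt13 (n r : ℕ) (hr : 2 ≤ r) (hn : 2 * r + 1 ≤ n)
    (𝒜 ℬ 𝒞 𝒟 ℰ ℱ : Finset (Finset ℕ))
    (h𝒜 : 𝒜 ⊆ sepSets n 1 r) (hint : Intersecting 𝒜)
    (hℬ : ℬ = 𝒜.filter fun A => 1 ∉ A ∧ (2 ∉ A ∨ n ∉ A))
    (h𝒞 : 𝒞 = 𝒜.filter fun A => 1 ∈ A ∧ 3 ∉ A)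
    (h𝒟 : 𝒟 = 𝒜.filter fun A => 1 ∈ A ∧ 3 ∈ A)
    (hℰ : ℰ = 𝒜.filter fun A => 2 ∈ A ∧ n ∈ A)
    (hℱ : ℱ = famImage ℬ ∩ famImage 𝒞) :
    Disjoint (famErase1 (famImage 𝒟)) (famErase1 (famImage ℰ)) ∧
      Disjoint (famErase1 (famImage 𝒟)) (famErase1 ℱ) ∧
      Disjoint (famErase1 (famImage ℰ)) (famErase1 ℱ) := by
  subst hℬ h𝒞 h𝒟 hℰ hℱ
  have key : ∀ G : Finset ℕ, n - 1 ∈ (G.image fmap).erase 1 ↔ n ∈ G := by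
    intro G
    rw [mem_erase_image_fmap G (n - 1) (by omega), Nat.sub_add_cancel (by omega)]
  have key2 : ∀ G : Finset ℕ, 2 ∈ (G.image fmap).erase 1 ↔ 3 ∈ G := fun G =>
    mem_erase_image_fmap G 2 le_rfl
  have hno : ∀ A ∈ 𝒜, 1 ∈ A → n ∉ A := fun A hA =>
    not_mem_of_one_mem n r (by omega) A (h𝒜 hA)
  simp only [Finset.disjoint_left, famErase1, famImage, Finset.mem_image, Finset.mem_inter,
    Finset.mem_filter]
  refine ⟨?_, ?_, ?_⟩
  · rintro _ ⟨_, ⟨D, ⟨hD, h1, h3⟩, rfl⟩, rfl⟩ ⟨_, ⟨E, ⟨hE, h2, hnE⟩, rfl⟩, h⟩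
    have := (key E).2 hnE
    rw [h, key] at this
    exact hno D hD h1 this
  · rintro _ ⟨_, ⟨D, ⟨hD, h1, h3⟩, rfl⟩, rfl⟩ ⟨_, ⟨_, ⟨C, ⟨hC, h1C, h3C⟩, rfl⟩⟩, h⟩
    have := (key2 D).2 h3
    rw [← h, key2] at this
    exact h3C this
  · rintro _ ⟨_, ⟨E, ⟨hE, h2, hnE⟩, rfl⟩, rfl⟩ ⟨_, ⟨_, ⟨C, ⟨hC, h1C, h3C⟩, rfl⟩⟩, h⟩
    have := (key E).2 hnE
    rw [← h, key] at this
    exact hno C hC h1C this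
end

section
/- With 𝒜, f, ℬ, 𝒞, 𝒟, ℰ, ℱ, ℋ as in the context: the family ℋ is intersecting. -/
theorem stmt14_mem {A : Finset ℕ} {x : ℕ} (hx : x ∈ A) (h3 : 3 ≤ x) :
    x - 1 ∈ (A.image fmap).erase 1 := by
  refine Finset.mem_erase.2 ⟨by omega, Finset.mem_image.2 ⟨x, hx, ?_⟩⟩
  unfold fmap
  rw [if_neg (by omega)]

theorem stmt14 (n r : ℕ) (hr : 2 ≤ r) (hn : 2 * r + 1 ≤ n)
(𝒜 ℬ 𝒞 𝒟 ℰ ℱ ℋ : Finset (Finset ℕ))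
    (h𝒜 : 𝒜 ⊆ sepSets n 1 r) (hint : Intersecting 𝒜)
    (hℬ : ℬ = 𝒜.filter fun A => 1 ∉ A ∧ (2 ∉ A ∨ n ∉ A))
    (h𝒞 : 𝒞 = 𝒜.filter fun A => 1 ∈ A ∧ 3 ∉ A)
    (h𝒟 : 𝒟 = 𝒜.filter fun A => 1 ∈ A ∧ 3 ∈ A)
    (hℰ : ℰ = 𝒜.filter fun A => 2 ∈ A ∧ n ∈ A)
    (hℱ : ℱ = famImage ℬ ∩ famImage 𝒞)
    (hℋ : ℋ = famErase1 (famImage 𝒟) ∪ famErase1 (famImage ℰ) ∪ famErase1 ℱ) :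
    Intersecting ℋ := by
  have hsep : ∀ A ∈ 𝒜, (∀ x ∈ A, 1 ≤ x) ∧ (1 ∈ A → 2 ∉ A) := by
    intro A hA
    have h := h𝒜 hA
    simp only [sepSets, Finset.mem_filter, Finset.mem_powerset] at h
    refine ⟨fun x hx => (Finset.mem_Icc.1 (h.1 hx)).1, fun h1 h2 => ?_⟩
    have := h.2.2.2 1 h1 2 h2 (by omega)
    omega
  have key : ∀ A ∈ 𝒜, ∀ B ∈ 𝒜, 1 ∈ A → 1 ∉ B →
      ((A.image fmap).erase 1 ∩ (B.image fmap).erase 1).Nonempty := by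
    intro A hA B hB h1 h2
    obtain ⟨x, hx⟩ := hint A hA B hB
    obtain ⟨hxA, hxB⟩ := Finset.mem_inter.1 hx
    have hx1 := (hsep A hA).1 x hxA
    have hn2 := (hsep A hA).2 h1
    have hx2 : x ≠ 1 := fun h => h2 (h ▸ hxB)
    have hx3 : x ≠ 2 := fun h => hn2 (h ▸ hxA)
    exact ⟨x - 1, Finset.mem_inter.2
      ⟨stmt14_mem hxA (by omega), stmt14_mem hxB (by omega)⟩⟩
  have cls : ∀ H ∈ ℋ,
      ((∃ A ∈ 𝒜, 1 ∈ A ∧ (A.image fmap).erase 1 = H) ∧ 2 ∈ H) ∨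
      ((∃ A ∈ 𝒜, 1 ∉ A ∧ (A.image fmap).erase 1 = H) ∧ n - 1 ∈ H) ∨
      ((∃ A ∈ 𝒜, 1 ∈ A ∧ (A.image fmap).erase 1 = H) ∧
        (∃ A ∈ 𝒜, 1 ∉ A ∧ (A.image fmap).erase 1 = H)) := by
    intro H hH
    subst hℋ hℱ hℬ h𝒞 h𝒟 hℰ
    simp only [famErase1, famImage, Finset.mem_union, Finset.mem_image, Finset.mem_inter,
      Finset.mem_filter] at hH
    rcases hH with (⟨_, ⟨A, ⟨hA, h1, h3⟩, rfl⟩, rfl⟩ | ⟨_, ⟨A, ⟨hA, h2, hn'⟩, rfl⟩, rfl⟩) |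
      ⟨_, ⟨⟨B, ⟨hB, hB1, _⟩, rfl⟩, ⟨C, ⟨hC, hC1, _⟩, hCB⟩⟩, rfl⟩
    · exact Or.inl ⟨⟨A, hA, h1, rfl⟩, stmt14_mem h3 (by omega)⟩
    · exact Or.inr (Or.inl ⟨⟨A, hA, fun h => (hsep A hA).2 h h2, rfl⟩,
        stmt14_mem hn' (by omega)⟩)
    · exact Or.inr (Or.inr ⟨⟨C, hC, hC1, by rw [hCB]⟩, ⟨B, hB, hB1, rfl⟩⟩)
  have key2 : ∀ H K : Finset ℕ, (∃ A ∈ 𝒜, 1 ∈ A ∧ (A.image fmap).erase 1 = H) →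
      (∃ A ∈ 𝒜, 1 ∉ A ∧ (A.image fmap).erase 1 = K) → (H ∩ K).Nonempty := by
    rintro _ _ ⟨A, hA, h1, rfl⟩ ⟨B, hB, h2, rfl⟩
    exact key A hA B hB h1 h2
  intro H hH K hK
  rcases cls H hH with ⟨p, h2⟩ | ⟨q, h2⟩ | ⟨p, q⟩ <;>
  rcases cls K hK with ⟨p', h2'⟩ | ⟨q', h2'⟩ | ⟨p', q'⟩ <;>
  first
    | exact key2 H K p q'
    | (rw [Finset.inter_comm]; exact key2 K H p' q)
    | exact ⟨_, Finset.mem_inter.2 ⟨h2, h2'⟩⟩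
end

section
/- With 𝒜, f, ℬ, 𝒞, 𝒟, ℰ, ℱ, ℋ as in the context: every member of f(ℋ) is a separated (r−1)-subset of [n−2], i.e. f(ℋ) ⊆ [n−2]^(r−1)_*. -/
theorem key15 (n r p : ℕ) (hn : 5 ≤ n) (A : Finset ℕ) (hA : A ∈ sepSets n 1 r)
    (hp : p = 1 ∨ p = 2) (hpA : p ∈ A) :
    ((A.image fmap).erase 1).image fmap ∈ sepSets (n - 2) 1 (r - 1) := by
  simp only [sepSets, Finset.mem_filter, Finset.mem_powerset] at hA
  obtain ⟨hsub, hcard, -, hsep⟩ := hA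
  have hb : ∀ a ∈ A, a ≠ p → p + 2 ≤ a ∧ a + 2 ≤ n + p := by
    intro a ha hne
    have h1 := Finset.mem_Icc.1 (hsub ha)
    rcases lt_or_gt_of_ne hne with h | h
    · have := hsep a ha p hpA h
      omega
    · have := hsep p hpA a ha h
      omega
  have heq : ((A.image fmap).erase 1).image fmap = (A.erase p).image (fun x => x - 2) := by
    ext x
    simp only [Finset.mem_image, Finset.mem_erase]
    constructor
    · rintro ⟨y, ⟨hy, a, ha, rfl⟩, rfl⟩
      have hne : a ≠ p := by
        rintro rfl
        apply hy
        rcases hp with rfl | rfl <;> simp [fmap]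
      have := hb a ha hne
      refine ⟨a, ⟨hne, ha⟩, ?_⟩
      unfold fmap
      split_ifs <;> omega
    · rintro ⟨a, ⟨hne, ha⟩, rfl⟩
      have := hb a ha hne
      refine ⟨fmap a, ⟨?_, a, ha, rfl⟩, ?_⟩
      · unfold fmap
        split_ifs <;> omega
      · unfold fmap
        split_ifs <;> omega
  rw [heq]
  simp only [sepSets, Finset.mem_filter, Finset.mem_powerset]
  refine ⟨?_, ?_, by omega, ?_⟩
  · intro x hx
    obtain ⟨a, ha, rfl⟩ := Finset.mem_image.1 hx
    have ha' := Finset.mem_erase.1 ha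
    have h1 := hb a ha'.2 ha'.1
    have h2 := Finset.mem_Icc.1 (hsub ha'.2)
    rw [Finset.mem_Icc]
    omega
  · rw [Finset.card_image_of_injOn, Finset.card_erase_of_mem hpA, hcard]
    intro a ha b hb' hab
    have ha' := Finset.mem_erase.1 (Finset.mem_coe.1 ha)
    have hb'' := Finset.mem_erase.1 (Finset.mem_coe.1 hb')
    have h1 := hb a ha'.2 ha'.1
    have h2 := hb b hb''.2 hb''.1
    simp only at hab
    omega
  · intro x hx y hy hxy
    obtain ⟨a, ha, rfl⟩ := Finset.mem_image.1 hx
    obtain ⟨b, hb', rfl⟩ := Finset.mem_image.1 hy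
    have ha' := Finset.mem_erase.1 ha
    have hb'' := Finset.mem_erase.1 hb'
    have h1 := hb a ha'.2 ha'.1
    have h2 := hb b hb''.2 hb''.1
    have h3 := hsep a ha'.2 b hb''.2 (by omega)
    have h4 := Finset.mem_Icc.1 (hsub hb''.2)
    omega

theorem stmt15 (n r : ℕ) (hr : 2 ≤ r) (hn : 2 * r + 1 ≤ n)
(𝒜 ℬ 𝒞 𝒟 ℰ ℱ ℋ : Finset (Finset ℕ))
    (h𝒜 : 𝒜 ⊆ sepSets n 1 r) (hint : Intersecting 𝒜)
    (hℬ : ℬ = 𝒜.filter fun A => 1 ∉ A ∧ (2 ∉ A ∨ n ∉ A))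
    (h𝒞 : 𝒞 = 𝒜.filter fun A => 1 ∈ A ∧ 3 ∉ A)
    (h𝒟 : 𝒟 = 𝒜.filter fun A => 1 ∈ A ∧ 3 ∈ A)
    (hℰ : ℰ = 𝒜.filter fun A => 2 ∈ A ∧ n ∈ A)
    (hℱ : ℱ = famImage ℬ ∩ famImage 𝒞)
    (hℋ : ℋ = famErase1 (famImage 𝒟) ∪ famErase1 (famImage ℰ) ∪ famErase1 ℱ) :
    famImage ℋ ⊆ sepSets (n - 2) 1 (r - 1) := by
  subst hℬ h𝒞 h𝒟 hℰ hℱ hℋ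
  intro X hX
  simp only [famImage, famErase1, Finset.mem_image, Finset.mem_union, Finset.mem_inter,
    Finset.mem_filter] at hX
  obtain ⟨H, hH, rfl⟩ := hX
  rcases hH with (⟨G, ⟨A, ⟨hA, h1, h3⟩, rfl⟩, rfl⟩ | ⟨G, ⟨A, ⟨hA, h1, h3⟩, rfl⟩, rfl⟩) |
    ⟨G, ⟨-, A, ⟨hA, h1, h3⟩, rfl⟩, rfl⟩
  · exact key15 n r 1 (by omega) A (h𝒜 hA) (Or.inl rfl) h1
  · exact key15 n r 2 (by omega) A (h𝒜 hA) (Or.inr rfl) h1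
  · exact key15 n r 1 (by omega) A (h𝒜 hA) (Or.inl rfl) h1
end

section
/- Let n ≥ 2r+3, r ≥ 3, and let 𝒜 ⊆ [n]^(r)_* be an intersecting family of separated r-subsets of [n] with |𝒜| = binomial(n−r−1, r−1) and {A ∈ [n]^(r)_* : 1 ∈ A and 3 ∈ A} ⊆ 𝒜. Then (i) every set in 𝒜 has nonempty intersection with {1, 3}; and (ii) for every A = {1, a_2, ..., a_r} ∈ [n]^(r)_* with A ∩ {1, 3} = {1}, exactly one of the two sets A and g(A) = {3, a_2 + 1, ..., a_r + 1} belongs to 𝒜. -/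
open Finset in
lemma aux_count : ∀ (m k : ℕ),
    ((Finset.powersetCard k (Finset.Ico 3 (3 + m))).filter
      (fun A => ∀ a ∈ A, a + 1 ∉ A)).card ≤ (m + 1 - k).choose k := by
  intro m
  induction m using Nat.strong_induction_on with
  | _ m ih =>
  intro k
  rcases k with _ | k
  · refine (Finset.card_filter_le _ _).trans ?_
    simp
  rcases Nat.lt_or_ge m (k + 1) with hk | hk
  · rw [Finset.powersetCard_eq_empty.2 (by simpa using hk)]
    simp
  rcases m with _ | _ | m
  · omega
  · obtain rfl : k = 0 := by omega
    refine (Finset.card_filter_le _ _).trans ?_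
    simp
  have h1 := ih (m + 1) (by omega) (k + 1)
  have h0 := ih m (by omega) k
  have e : (m + 1 + 1 + 1 - (k + 1)).choose (k + 1)
      = (m + 1 - k).choose k + (m + 1 + 1 - (k + 1)).choose (k + 1) := by
    have : m + 1 + 1 + 1 - (k + 1) = (m + 1 - k) + 1 := by omega
    rw [this, Nat.choose_succ_succ]
    congr 2
    omega
  rw [e]
  refine le_trans ?_ (Nat.add_le_add h0 h1)
  rw [← Finset.card_filter_add_card_filter_not (fun A => (m + 4) ∈ A)]
  refine Nat.add_le_add ?_ ?_
  · refine Finset.card_le_card_of_injOn (fun A => A.erase (m + 4)) ?_ ?_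
    · intro A hA
      simp only [Finset.coe_filter, Finset.mem_filter, Finset.mem_powersetCard,
        Set.mem_setOf_eq] at hA ⊢
      obtain ⟨⟨⟨hs, hc⟩, hsep⟩, hm⟩ := hA
      refine ⟨⟨?_, ?_⟩, ?_⟩
      · intro x hx
        rw [Finset.mem_erase] at hx
        have h2 := Finset.mem_Ico.1 (hs hx.2)
        have h3 : x ≠ m + 3 := by
          rintro rfl
          exact hsep _ hx.2 hm
        rw [Finset.mem_Ico]
        omega
      · rw [Finset.card_erase_of_mem hm, hc]; rfl
      · intro a ha hb
        exact hsep a (Finset.mem_of_mem_erase ha) (Finset.mem_of_mem_erase hb)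
    · intro A hA B hB h
      have hA' := (Finset.mem_filter.1 hA).2
      have hB' := (Finset.mem_filter.1 hB).2
      rw [← Finset.insert_erase hA', ← Finset.insert_erase hB']
      exact congrArg _ h
  · refine Finset.card_le_card ?_
    intro A hA
    simp only [Finset.mem_filter, Finset.mem_powersetCard] at hA ⊢
    obtain ⟨⟨⟨hs, hc⟩, hsep⟩, hm⟩ := hA
    refine ⟨⟨?_, hc⟩, hsep⟩
    intro x hx
    have h2 := Finset.mem_Ico.1 (hs hx)
    have h3 : x ≠ m + 4 := by
      rintro rfl
      exact hm hx
    rw [Finset.mem_Ico]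
    omega

lemma mem_sep {n r : ℕ} {A : Finset ℕ} : A ∈ sepSets n 1 r ↔
    (∀ a ∈ A, 1 ≤ a ∧ a ≤ n) ∧ A.card = r ∧ 1 < n ∧
      ∀ a ∈ A, ∀ b ∈ A, a < b → 1 < b - a ∧ b - a + 1 < n := by
  simp only [sepSets, Finset.mem_filter, Finset.mem_powerset, Finset.subset_iff, Finset.mem_Icc]

lemma count_one (n r : ℕ) (hr : 3 ≤ r) (hn : 2 * r + 3 ≤ n) :
    ((sepSets n 1 r).filter (fun A => 1 ∈ A)).card ≤ (n - r - 1).choose (r - 1) := by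
  have h := aux_count (n - 3) (r - 1)
  have e : n - 3 + 1 - (r - 1) = n - r - 1 := by omega
  rw [e] at h
  refine le_trans ?_ h
  refine Finset.card_le_card_of_injOn (fun A => A.erase 1) ?_ ?_
  · intro A hA
    simp only [Finset.coe_filter, Finset.mem_powersetCard, Set.mem_setOf_eq, mem_sep] at hA ⊢
    obtain ⟨⟨hs, hc, -, hsep⟩, hm⟩ := hA
    refine ⟨⟨?_, ?_⟩, ?_⟩
    · intro x hx
      rw [Finset.mem_erase] at hx
      have h1 := hs x hx.2
      have h2 := hsep 1 hm x hx.2 (by omega)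
      rw [Finset.mem_Ico]
      omega
    · rw [Finset.card_erase_of_mem hm, hc]
    · intro a ha hb
      have := hsep a (Finset.mem_of_mem_erase ha) _ (Finset.mem_of_mem_erase hb) (by omega)
      omega
  · intro A hA B hB h
    have hA' := (Finset.mem_filter.1 hA).2
    have hB' := (Finset.mem_filter.1 hB).2
    rw [← Finset.insert_erase hA', ← Finset.insert_erase hB']
    exact congrArg _ h

/-- The map g of the statement. -/
def gmap (A : Finset ℕ) : Finset ℕ := A.image fun a => if a = 1 then 3 else a + 1

/-- Its inverse. -/
def hmap (A : Finset ℕ) : Finset ℕ := A.image fun a => if a = 3 then 1 else a - 1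

lemma g_disj {n r : ℕ} {A : Finset ℕ} (hA : A ∈ sepSets n 1 r) (h3 : 3 ∉ A) :
    ¬ (A ∩ gmap A).Nonempty := by
  rintro ⟨x, hx⟩
  rw [Finset.mem_inter, gmap, Finset.mem_image] at hx
  obtain ⟨hx, a, ha, rfl⟩ := hx
  split_ifs at hx with h
  · exact h3 hx
  · have := (mem_sep.1 hA).2.2.2 a ha _ hx (by omega)
    omega

lemma h_bounds {n r : ℕ} {B : Finset ℕ} (hB : B ∈ sepSets n 1 r) (h1 : 1 ∉ B) (h3 : 3 ∈ B) :
    ∀ b ∈ B, b = 3 ∨ (5 ≤ b ∧ b ≤ n) := by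
  intro b hb
  obtain ⟨hs, hc, -, hsep⟩ := mem_sep.1 hB
  have := hs b hb
  have h1' : b ≠ 1 := by rintro rfl; exact h1 hb
  rcases lt_trichotomy b 3 with h | h | h
  · have := hsep b hb 3 h3 h
    omega
  · exact Or.inl h
  · have := hsep 3 h3 b hb h
    omega

lemma h_sep {n r : ℕ} (hn : 5 ≤ n) {B : Finset ℕ} (hB : B ∈ sepSets n 1 r) (h1 : 1 ∉ B)
    (h3 : 3 ∈ B) : hmap B ∈ sepSets n 1 r := by
  have hb := h_bounds hB h1 h3
  obtain ⟨hs, hc, hn1, hsep⟩ := mem_sep.1 hB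
  refine mem_sep.2 ⟨?_, ?_, hn1, ?_⟩
  · intro a ha
    obtain ⟨b, hbB, rfl⟩ := Finset.mem_image.1 ha
    have := hb b hbB
    try dsimp only
    split_ifs <;> omega
  · rw [hmap, Finset.card_image_of_injOn, hc]
    intro a ha b hb' h
    have h4 := hb a ha
    have h5 := hb b hb'
    dsimp only at h
    split_ifs at h <;> omega
  · intro a ha c hcc
    obtain ⟨b, hbB, rfl⟩ := Finset.mem_image.1 ha
    obtain ⟨d, hdB, rfl⟩ := Finset.mem_image.1 hcc
    have h4 := hb b hbB
    have h5 := hb d hdB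
    have h6 := hsep b hbB d hdB
    try dsimp only
    split_ifs <;> omega

lemma g_h {n r : ℕ} {B : Finset ℕ} (hB : B ∈ sepSets n 1 r) (h1 : 1 ∉ B)
    (h3 : 3 ∈ B) : gmap (hmap B) = B := by
  have hb := h_bounds hB h1 h3
  rw [gmap, hmap, Finset.image_image]
  refine (Finset.image_congr ?_).trans Finset.image_id
  intro b hbB
  have := hb b hbB
  simp only [Function.comp, id]
  split_ifs <;> omega

lemma part_one (n r : ℕ) (hr : 3 ≤ r) (hn : 2 * r + 3 ≤ n) {A : Finset ℕ}
    (hA : A ∈ sepSets n 1 r) (h1 : 1 ∉ A) (h3 : 3 ∉ A) :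
    ∃ B ∈ sepSets n 1 r, 1 ∈ B ∧ 3 ∈ B ∧ ¬ (A ∩ B).Nonempty := by
  obtain ⟨hs, hc, hn1, hsep⟩ := mem_sep.1 hA
  have hlow : (A.filter (fun a => a < 6)).card ≤ 2 := by
    by_contra hcon
    have hsubs : A.filter (fun a => a < 6) ⊆ {2, 4, 5} := by
      intro x hx
      obtain ⟨hx, hx6⟩ := Finset.mem_filter.1 hx
      have := hs x hx
      have : x ≠ 1 := by rintro rfl; exact h1 hx
      have : x ≠ 3 := by rintro rfl; exact h3 hx
      simp only [Finset.mem_insert, Finset.mem_singleton]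
      omega
    have heq := Finset.eq_of_subset_of_card_le hsubs
      (le_trans (Finset.card_le_three) (by omega))
    have h4 : 4 ∈ A := (Finset.mem_filter.1 (heq ▸ (by simp : (4 : ℕ) ∈ ({2, 4, 5} : Finset ℕ)))).1
    have h5 : 5 ∈ A := (Finset.mem_filter.1 (heq ▸ (by simp : (5 : ℕ) ∈ ({2, 4, 5} : Finset ℕ)))).1
    have := hsep 4 h4 5 h5 (by omega)
    omega
  have hsplit := Finset.card_filter_add_card_filter_not (s := A) (fun a => a < 6)
  obtain ⟨C, hCs, hCc⟩ := Finset.exists_subset_card_eq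
    (s := A.filter (fun a => ¬ a < 6)) (n := r - 2) (by omega)
  have hC : ∀ c ∈ C, c ∈ A ∧ 6 ≤ c ∧ c ≤ n := by
    intro c hcC
    have h := Finset.mem_filter.1 (hCs hcC)
    have := hs c h.1
    exact ⟨h.1, by omega, by omega⟩
  have hD : ∀ d ∈ C.image (fun c => c - 1), d + 1 ∈ A ∧ 5 ≤ d ∧ d + 1 ≤ n := by
    intro d hd
    obtain ⟨c, hcC, rfl⟩ := Finset.mem_image.1 hd
    have h := hC c hcC
    have e : c - 1 + 1 = c := by omega
    try dsimp only
    rw [e]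
    exact ⟨h.1, by omega, by omega⟩
  have hDc : (C.image (fun c => c - 1)).card = r - 2 := by
    rw [Finset.card_image_of_injOn, hCc]
    intro a ha b hb h
    have := hC a ha
    have := hC b hb
    dsimp only at h
    omega
  generalize C.image (fun c => c - 1) = D at hD hDc
  have hB : ∀ x ∈ insert 1 (insert 3 D), x = 1 ∨ x = 3 ∨ x ∈ D := by
    intro x hx
    simpa using hx
  refine ⟨insert 1 (insert 3 D), mem_sep.2 ⟨?_, ?_, hn1, ?_⟩, by simp, by simp, ?_⟩
  · intro x hx
    rcases hB x hx with rfl | rfl | hx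
    · omega
    · omega
    · have := hD x hx
      omega
  · have h3D : 3 ∉ D := fun h => by have := hD 3 h; omega
    have h1D : 1 ∉ insert 3 D := fun h => by
      rcases Finset.mem_insert.1 h with h | h
      · omega
      · have := hD 1 h; omega
    rw [Finset.card_insert_of_notMem h1D, Finset.card_insert_of_notMem h3D, hDc]
    omega
  · intro a ha b hb hab
    rcases hB a ha with rfl | rfl | ha <;> rcases hB b hb with rfl | rfl | hb
    · omega
    · omega
    · have := hD b hb
      omega
    · omega
    · omega
    · have := hD b hb
      omega
    · have := hD a ha
      omega
    · have := hD a ha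
      omega
    · have h4 := hD a ha
      have h5 := hD b hb
      have := hsep _ h4.1 _ h5.1 (by omega)
      omega
  · rintro ⟨x, hx⟩
    rw [Finset.mem_inter] at hx
    rcases hB x hx.2 with rfl | rfl | hxD
    · exact h1 hx.1
    · exact h3 hx.1
    · have := hsep _ hx.1 _ (hD x hxD).1 (by omega)
      omega

theorem stmt16 (n r : ℕ) (hr : 3 ≤ r) (hn : 2 * r + 3 ≤ n)
    (𝒜 : Finset (Finset ℕ)) (h𝒜 : 𝒜 ⊆ sepSets n 1 r) (hint : Intersecting 𝒜)
    (hcard : 𝒜.card = (n - r - 1).choose (r - 1))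
    (hsub : ((sepSets n 1 r).filter fun A => 1 ∈ A ∧ 3 ∈ A) ⊆ 𝒜) :
    (∀ A ∈ 𝒜, (A ∩ ({1, 3} : Finset ℕ)).Nonempty) ∧
      ∀ A ∈ sepSets n 1 r, A ∩ ({1, 3} : Finset ℕ) = {1} →
        Xor' (A ∈ 𝒜) ((A.image fun a => if a = 1 then 3 else a + 1) ∈ 𝒜) := by
  have hone : ∀ A ∈ 𝒜, 1 ∉ A → 3 ∈ A := by
    intro A hA h1
    by_contra h3
    obtain ⟨B, hB, hB1, hB3, hdis⟩ := part_one n r hr hn (h𝒜 hA) h1 h3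
    exact hdis (hint A hA B (hsub (Finset.mem_filter.2 ⟨hB, hB1, hB3⟩)))
  refine ⟨?_, ?_⟩
  · intro A hA
    by_cases h1 : 1 ∈ A
    · exact ⟨1, by simp [h1]⟩
    · exact ⟨3, by simp [hone A hA h1]⟩
  intro A₀ hA₀ hA₀i
  change Xor' (A₀ ∈ 𝒜) (gmap A₀ ∈ 𝒜)
  have h1 : 1 ∈ A₀ := by
    have : 1 ∈ A₀ ∩ ({1, 3} : Finset ℕ) := by rw [hA₀i]; simp
    exact (Finset.mem_inter.1 this).1
  have h3 : 3 ∉ A₀ := by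
    intro h
    have : 3 ∈ A₀ ∩ ({1, 3} : Finset ℕ) := by simp [h]
    rw [hA₀i] at this
    simp at this
  have hnot : ¬ (A₀ ∈ 𝒜 ∧ gmap A₀ ∈ 𝒜) := fun h =>
    g_disj hA₀ h3 (hint _ h.1 _ h.2)
  have hor : A₀ ∈ 𝒜 ∨ gmap A₀ ∈ 𝒜 := by
    by_contra hcon
    push Not at hcon
    have hle : 𝒜.card ≤ (((sepSets n 1 r).filter (fun A => 1 ∈ A)).erase A₀).card := by
      have hh1 : ∀ B ∈ 𝒜, 1 ∉ B → 1 ∈ hmap B := fun B hB hB1 =>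
        Finset.mem_image.2 ⟨3, hone B hB hB1, by simp⟩
      have hh3 : ∀ B ∈ 𝒜, 1 ∉ B → 3 ∉ hmap B := by
        intro B hB hB1 h
        obtain ⟨b, hb, hbe⟩ := Finset.mem_image.1 h
        have := h_bounds (h𝒜 hB) hB1 (hone B hB hB1) b hb
        split_ifs at hbe <;> omega
      have hgh : ∀ B ∈ 𝒜, 1 ∉ B → gmap (hmap B) = B := fun B hB hB1 =>
        g_h (h𝒜 hB) hB1 (hone B hB hB1)
      have hhs : ∀ B ∈ 𝒜, 1 ∉ B → hmap B ∈ sepSets n 1 r := fun B hB hB1 =>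
        h_sep (by omega) (h𝒜 hB) hB1 (hone B hB hB1)
      have hmix : ∀ B ∈ 𝒜, 1 ∉ B → hmap B ∉ 𝒜 := by
        intro B hB hB1 h
        apply g_disj (hhs B hB hB1) (hh3 B hB hB1)
        rw [hgh B hB hB1]
        exact hint _ h _ hB
      refine Finset.card_le_card_of_injOn (fun A => if 1 ∈ A then A else hmap A) ?_ ?_
      · intro A hA
        have hA : A ∈ 𝒜 := hA
        rw [Finset.mem_coe, Finset.mem_erase, Finset.mem_filter]
        dsimp only
        split_ifs with hA1
        · exact ⟨fun h => hcon.1 (h ▸ hA), h𝒜 hA, hA1⟩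
        · refine ⟨fun h => hcon.2 ?_, hhs A hA hA1, hh1 A hA hA1⟩
          rw [← h, hgh A hA hA1]
          exact hA
      · intro A hA B hB h
        have hA : A ∈ 𝒜 := hA
        have hB : B ∈ 𝒜 := hB
        dsimp only at h
        split_ifs at h with hA1 hB1 hB1
        · exact h
        · exact absurd (h ▸ hA) (hmix B hB hB1)
        · exact absurd (h ▸ hB) (hmix A hA hA1)
        · rw [← hgh A hA hA1, h, hgh B hB hB1]
    have hmem : A₀ ∈ (sepSets n 1 r).filter (fun A => 1 ∈ A) :=
      Finset.mem_filter.2 ⟨hA₀, h1⟩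
    have hlt := Finset.card_erase_lt_of_mem hmem
    have := count_one n r hr hn
    omega
  rcases hor with h | h
  · exact Or.inl ⟨h, fun h' => hnot ⟨h, h'⟩⟩
  · exact Or.inr ⟨h, fun h' => hnot ⟨h', h⟩⟩
end

section
/- With 𝒜, f, ℬ, 𝒞, 𝒟_0, ..., 𝒟_k, ℰ, ℱ as in the context: the family ℱ is intersecting. -/
theorem aux_iter (k x : ℕ) (hx : k + 1 ≤ x) : fmap^[k] x = x - k := by
  induction k with
  | zero => simp
  | succ k ih =>
    rw [Function.iterate_succ_apply', ih (by omega)]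
    unfold fmap
    split_ifs <;> omega

theorem aux_inter (k x : ℕ) (A B : Finset ℕ) (hA : x ∈ A) (hB : x ∈ B) (hx : k + 2 ≤ x) :
    ((A.image (fmap^[k])).erase 1 ∩ (B.image (fmap^[k])).erase 1).Nonempty := by
  have h := aux_iter k x (by omega)
  refine ⟨x - k, ?_⟩
  simp only [Finset.mem_inter, Finset.mem_erase, Finset.mem_image]
  exact ⟨⟨by omega, x, hA, h⟩, ⟨by omega, x, hB, h⟩⟩

theorem stmt18 (n k r : ℕ) (hk : 2 ≤ k) (hr : 3 ≤ r) (hn : (k + 1) * r + 1 ≤ n)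
    (𝒜 ℬ 𝒞 ℰ ℱ : Finset (Finset ℕ)) (𝒟 : ℕ → Finset (Finset ℕ))
    (h𝒜 : 𝒜 ⊆ sepSets n k r) (hint : Intersecting 𝒜)
    (hℬ : ℬ = 𝒜.filter fun A => 1 ∉ A ∧ A.image fmap ∈ sepSets (n - 1) k r)
    (h𝒞 : 𝒞 = 𝒜.filter fun A => 1 ∈ A ∧ A.image fmap ∈ sepSets (n - 1) k r)
    (h𝒟0 : 𝒟 0 = 𝒜.filter fun A => 1 ∈ A ∧ k + 2 ∈ A)
    (h𝒟i : ∀ i, 1 ≤ i → i ≤ k →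
      𝒟 i = 𝒜.filter fun A => n + 1 - i ∈ A ∧ k + 2 - i ∈ A)
    (hℰ : ℰ = famImage ℬ ∩ famImage 𝒞)
    (hℱ : ℱ = famErase1 (famImageIter (k - 1) ℰ) ∪
      (Finset.range (k + 1)).biUnion fun i => famErase1 (famImageIter k (𝒟 i))) :
    Intersecting ℱ := by
  have hn' : 3 * (k + 1) + 1 ≤ n := by nlinarith
  have hsep : ∀ A ∈ 𝒜, ∀ x ∈ A, 1 ≤ x ∧ x ≤ n := by
    intro A hA x hx
    have h := h𝒜 hA
    simp only [sepSets, Finset.mem_filter, Finset.mem_powerset] at h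
    exact Finset.mem_Icc.1 (h.1 hx)
  have hgap : ∀ A ∈ 𝒜, ∀ a ∈ A, ∀ b ∈ A, a < b → k < b - a ∧ b - a + k < n := by
    intro A hA
    have h := h𝒜 hA
    simp only [sepSets, Finset.mem_filter, Finset.mem_powerset] at h
    exact h.2.2.2
  -- the two kinds of members
  have key : ∀ S ∈ ℱ,
      (∃ A ∈ 𝒜, S = (A.image (fmap^[k])).erase 1 ∧ ∃ s t, t ∈ A ∧ k + 2 ≤ t ∧
        1 ≤ s ∧ s ≤ k + 1 ∧ (∀ x ∈ A, x ≤ k + 1 → x = s) ∧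
        ((s = 1 ∧ t = k + 2) ∨ (2 ≤ s ∧ t + (k + 1) = n + s))) ∨
      (∃ B ∈ 𝒜, ∃ C ∈ 𝒜, S = (B.image (fmap^[k])).erase 1 ∧
        S = (C.image (fmap^[k])).erase 1 ∧ (∀ x ∈ B, x ≤ k + 1 → x = 2) ∧
        (∀ x ∈ C, x ≤ k + 1 → x = 1)) := by
    intro S hS
    rw [hℱ, Finset.mem_union] at hS
    rcases hS with hS | hS
    · right
      simp only [famErase1, famImageIter, Finset.mem_image] at hS
      obtain ⟨_, ⟨E, hE, rfl⟩, rfl⟩ := hS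
      rw [hℰ, Finset.mem_inter] at hE
      simp only [famImage, Finset.mem_image] at hE
      obtain ⟨⟨B, hB, hBE⟩, ⟨C, hC, hCE⟩⟩ := hE
      rw [hℬ, Finset.mem_filter] at hB
      rw [h𝒞, Finset.mem_filter] at hC
      have hit : fmap^[k] = fmap^[k - 1] ∘ fmap := by
        rw [← Function.iterate_succ]
        congr 1
        omega
      have hB2 : 2 ∈ B := by
        have h1 : 1 ∈ E := by
          rw [← hCE]
          exact Finset.mem_image.2 ⟨1, hC.2.1, rfl⟩
        rw [← hBE] at h1
        obtain ⟨b, hb, hb1⟩ := Finset.mem_image.1 h1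
        have hb' : b ≠ 1 := fun h => hB.2.1 (h ▸ hb)
        have : b = 2 := by
          unfold fmap at hb1
          split_ifs at hb1 <;> omega
        exact this ▸ hb
      refine ⟨B, hB.1, C, hC.1, ?_, ?_, ?_, ?_⟩
      · rw [hit, ← Finset.image_image, hBE]
      · rw [hit, ← Finset.image_image, hCE]
      · intro x hx hxk
        have h1 := hsep B hB.1 x hx
        have h2 : x ≠ 1 := fun h => hB.2.1 (h ▸ hx)
        by_contra h3
        have := hgap B hB.1 2 hB2 x hx (by omega)
        omega
      · intro x hx hxk
        have h1 := hsep C hC.1 x hx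
        by_contra h3
        have := hgap C hC.1 1 hC.2.1 x hx (by omega)
        omega
    · left
      simp only [famErase1, famImageIter, Finset.mem_image, Finset.mem_biUnion,
        Finset.mem_range] at hS
      obtain ⟨i, hi, _, ⟨A, hA, rfl⟩, rfl⟩ := hS
      by_cases h0 : i = 0
      · subst h0
        rw [h𝒟0, Finset.mem_filter] at hA
        refine ⟨A, hA.1, rfl, 1, k + 2, hA.2.2, le_rfl, le_rfl, by omega, ?_, Or.inl ⟨rfl, rfl⟩⟩
        intro x hx hxk
        have h1 := hsep A hA.1 x hx
        by_contra h3
        have := hgap A hA.1 1 hA.2.1 x hx (by omega)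
        omega
      · rw [h𝒟i i (by omega) (by omega), Finset.mem_filter] at hA
        refine ⟨A, hA.1, rfl, k + 2 - i, n + 1 - i, hA.2.1, by omega, by omega, by omega, ?_,
          Or.inr ⟨by omega, by omega⟩⟩
        intro x hx hxk
        have h1 := hsep A hA.1 x hx
        by_contra h3
        rcases lt_or_gt_of_ne h3 with h4 | h4
        · have := hgap A hA.1 x hx _ hA.2.2 h4
          omega
        · have := hgap A hA.1 _ hA.2.2 x hx h4
          omega
  have fin : ∀ A ∈ 𝒜, ∀ B ∈ 𝒜, ∀ s t, (∀ x ∈ A, x ≤ k + 1 → x = s) →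
      (∀ x ∈ B, x ≤ k + 1 → x = t) → s ≠ t →
      ((A.image (fmap^[k])).erase 1 ∩ (B.image (fmap^[k])).erase 1).Nonempty := by
    intro A hA B hB s t hs ht hst
    obtain ⟨x, hx⟩ := hint A hA B hB
    rw [Finset.mem_inter] at hx
    refine aux_inter k x A B hx.1 hx.2 ?_
    by_contra h
    exact hst ((hs x hx.1 (by omega)).symm.trans (ht x hx.2 (by omega)))
  intro S hS T hT
  rcases key S hS with ⟨A, hA, rfl, s, t, htA, ht, hs1, hs2, hs, hst⟩ | ⟨B, hB, C, hC, e1, e2, hB2, hC1⟩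
  · rcases key T hT with ⟨A', hA', rfl, s', t', htA', ht', hs1', hs2', hs', hst'⟩ |
      ⟨B, hB, C, hC, e1, e2, hB2, hC1⟩
    · by_cases h : s = s'
      · have : t = t' := by omega
        subst this
        exact aux_inter k t A A' htA htA' ht
      · exact fin A hA A' hA' s s' hs hs' h
    · by_cases h : s = 1
      · rw [e1]
        exact fin A hA B hB s 2 hs hB2 (by omega)
      · rw [e2]
        exact fin A hA C hC s 1 hs hC1 h
  · rcases key T hT with ⟨A', hA', rfl, s', t', htA', ht', hs1', hs2', hs', hst'⟩ |
      ⟨B', hB', C', hC', e1', e2', hB2', hC1'⟩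
    · by_cases h : s' = 1
      · rw [e1]
        exact fin B hB A' hA' 2 s' hB2 hs' (by omega)
      · rw [e2]
        exact fin C hC A' hA' 1 s' hC1 hs' (by omega)
    · rw [e1, e2']
      exact fin B hB C' hC' 2 1 hB2 hC1' (by omega)
end

section
/- Let n, k, r be positive integers with n ≥ (k+1)r, and let A_1, A_2 ∈ [n]^(r)_k be distinct k-separated r-subsets of [n]. If there exists a set B ∈ Γ(A_1) ∩ Γ(A_2), then A_1 ∩ A_2 = ∅. Equivalently, if A_1 ≠ A_2 and A_1 ∩ A_2 ≠ ∅, then Γ(A_1) and Γ(A_2) are disjoint. -/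
/-- `Γ(A)`: the `(k+1)r`-subsets `B` of `[n]` obtained from `A` by inserting
exactly `k` new elements into each circular gap of `A`. -/
def Gamma (n k r : ℕ) (A : Finset ℕ) : Finset (Finset ℕ) :=
  (Finset.Icc 1 n).powerset.filter fun B =>
    B.card = (k + 1) * r ∧ A ⊆ B ∧
      ∀ a ∈ A, ((B \ A).filter fun x =>
        (a < x ∧ x < circSucc n A a) ∨ (a < x + n ∧ x + n < circSucc n A a)).card = k

/-- Number of elements of `B` strictly below `x`. -/
def rankIn (B : Finset ℕ) (x : ℕ) : ℕ := (B.filter fun y => y < x).card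

theorem rankIn_lt {B : Finset ℕ} {x y : ℕ} (hx : x ∈ B) (hxy : x < y) :
    rankIn B x < rankIn B y := by
  apply Finset.card_lt_card
  rw [Finset.ssubset_iff_of_subset]
  · exact ⟨x, by simp [hx, hxy], by simp⟩
  · intro z hz
    simp only [Finset.mem_filter] at hz ⊢
    exact ⟨hz.1, hz.2.trans hxy⟩

theorem rankIn_step (n k r : ℕ) (A B : Finset ℕ) (hB : B ∈ Gamma n k r A) (p x : ℕ)
    (hp : p ∈ A) (hx : x ∈ A) (hpx : p < x) (hno : ∀ y ∈ A, p < y → x ≤ y) :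
    rankIn B x = rankIn B p + (k + 1) := by
  simp only [Gamma, Finset.mem_filter, Finset.mem_powerset] at hB
  obtain ⟨hBn, -, hAB, hg⟩ := hB
  have hne : (A.filter fun b => p < b).Nonempty := ⟨x, by simp [hx, hpx]⟩
  have hs : circSucc n A p = x := by
    unfold circSucc
    rw [dif_pos hne]
    apply le_antisymm
    · exact Finset.min'_le _ _ (by simp [hx, hpx])
    · apply Finset.le_min'
      intro y hy
      rw [Finset.mem_filter] at hy
      exact hno y hy.1 hy.2
  have hk := hg p hp
  rw [hs] at hk
  have hxn := Finset.mem_Icc.mp (hBn (hAB hx))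
  set G := (B \ A).filter fun z => (p < z ∧ z < x) ∨ (p < z + n ∧ z + n < x) with hG
  have hset : (B.filter fun y => y < x) = insert p ((B.filter fun y => y < p) ∪ G) := by
    ext y
    simp only [hG, Finset.mem_filter, Finset.mem_insert, Finset.mem_union, Finset.mem_sdiff]
    constructor
    · rintro ⟨h1, h2⟩
      rcases lt_trichotomy y p with h | h | h
      · exact Or.inr (Or.inl ⟨h1, h⟩)
      · exact Or.inl h
      · refine Or.inr (Or.inr ⟨⟨h1, fun hA => ?_⟩, Or.inl ⟨h, h2⟩⟩)
        have := hno y hA h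
        omega
    · rintro (h | ⟨h1, h2⟩ | ⟨⟨h1, -⟩, h2⟩)
      · subst h
        exact ⟨hAB hp, hpx⟩
      · exact ⟨h1, by omega⟩
      · exact ⟨h1, by omega⟩
  unfold rankIn
  rw [hset, Finset.card_insert_of_notMem, Finset.card_union_of_disjoint, hk]
  · ring
  · rw [Finset.disjoint_left]
    intro y hy hy2
    simp only [hG, Finset.mem_filter] at hy hy2
    omega
  · simp only [hG, Finset.mem_filter, Finset.mem_union, Finset.mem_sdiff]
    rintro (h | h)
    · omega
    · exact h.1.2 hp

theorem rankIn_mod (n k r : ℕ) (A B : Finset ℕ) (hB : B ∈ Gamma n k r A) (hA : A.Nonempty)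
    (x : ℕ) (hx : x ∈ A) : rankIn B x % (k + 1) = rankIn B (A.min' hA) % (k + 1) := by
  induction x using Nat.strong_induction_on with
  | _ x ih =>
    by_cases hne : (A.filter fun b => b < x).Nonempty
    · have hm := Finset.max'_mem _ hne
      set p := (A.filter fun b => b < x).max' hne with hpdef
      rw [Finset.mem_filter] at hm
      rw [rankIn_step n k r A B hB p x hm.1 hx hm.2, Nat.add_mod_right, ih p hm.2 hm.1]
      intro y hy hpy
      by_contra hlt
      have := Finset.le_max' (A.filter fun b => b < x) y (by simp [hy]; omega)
      omega
    · have : A.min' hA = x := by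
        apply le_antisymm (Finset.min'_le _ _ hx)
        apply Finset.le_min'
        intro y hy
        by_contra hlt
        exact hne ⟨y, by simp [hy]; omega⟩
      rw [this]

theorem eq_residue (n k r : ℕ) (A B : Finset ℕ) (hS : A ∈ sepSets n k r)
    (hB : B ∈ Gamma n k r A) (a : ℕ) (ha : a ∈ A) :
    A = B.filter fun x => rankIn B x % (k + 1) = rankIn B a % (k + 1) := by
  have hA : A.Nonempty := ⟨a, ha⟩
  have hmod := rankIn_mod n k r A B hB hA
  simp only [sepSets, Finset.mem_filter] at hS
  simp only [Gamma, Finset.mem_filter] at hB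
  obtain ⟨-, hc, hAB, -⟩ := hB
  apply Finset.eq_of_subset_of_card_le
  · intro x hx
    rw [Finset.mem_filter]
    exact ⟨hAB hx, (hmod x hx).trans (hmod a ha).symm⟩
  · rw [hS.2.1, ← Finset.card_range r]
    apply Finset.card_le_card_of_injOn (fun x => rankIn B x / (k + 1))
    · intro x hx
      have hx' := (Finset.mem_filter.mp hx).1
      have hlt : rankIn B x < B.card := by
        apply Finset.card_lt_card
        rw [Finset.ssubset_iff_of_subset (Finset.filter_subset _ _)]
        exact ⟨x, hx', by simp⟩
      rw [hc] at hlt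
      simp only [Finset.coe_range, Set.mem_Iio]
      exact Nat.div_lt_of_lt_mul hlt
    · intro x hx y hy hxy
      have hx' := Finset.mem_filter.mp hx
      have hy' := Finset.mem_filter.mp hy
      have heq : rankIn B x = rankIn B y := by
        rw [← Nat.div_add_mod (rankIn B x) (k + 1), ← Nat.div_add_mod (rankIn B y) (k + 1),
          hx'.2, hy'.2]
        simp only at hxy
        rw [hxy]
      rcases lt_trichotomy x y with h | h | h
      · have := rankIn_lt hx'.1 h
        omega
      · exact h
      · have := rankIn_lt hy'.1 h
        omega

theorem stmt19 (n k r : ℕ) (hk : 1 ≤ k) (hr : 1 ≤ r) (hn : (k + 1) * r ≤ n)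
    (A₁ A₂ : Finset ℕ) (h₁ : A₁ ∈ sepSets n k r) (h₂ : A₂ ∈ sepSets n k r)
    (hne : A₁ ≠ A₂) (B : Finset ℕ) (hB₁ : B ∈ Gamma n k r A₁) (hB₂ : B ∈ Gamma n k r A₂) :
    A₁ ∩ A₂ = ∅ := by
  by_contra hcon
  obtain ⟨a, ha⟩ := Finset.nonempty_iff_ne_empty.mpr hcon
  rw [Finset.mem_inter] at ha
  exact hne ((eq_residue n k r A₁ B h₁ hB₁ a ha.1).trans
    (eq_residue n k r A₂ B h₂ hB₂ a ha.2).symm)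
end
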